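/- arXiv:1511.07027 — 17 statements merged into one kernel-verified Lean document; each statement's English description precedes it below -/
import Mathlib

section
/- Suppose two local (2k+1)-point viscosity-form schemes for the same flux f and mesh ratio λ, given by coefficient families Q^0, Q^{i+}, Q^{i−} and Q̃^0, Q̃^{i+}, Q̃^{i−} (both vanishing for i ≥ k), define the same update map H(U) for every step sequence U : ℤ → ℝ of the form U_j = u_L for j ≤ p and U_j = u_R for j > p (for every p ∈ ℤ and every u_L, u_R ∈ ℝ). Then Q^0(u_L,u_R) = Q̃^0(u_L,u_R) and Q^{i+}(u_L,u_R) = Q̃^{i+}(u_L,u_R), Q^{i−}(u_L,u_R) = Q̃^{i−}(u_L,u_R) for every i ≥ 1 and every pair u_L ≠ u_R. -/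
/-- Numerical flux `F_{j+1/2}` of a local (2k+1)-point viscosity-form scheme. -/
noncomputable def viscF (lam : ℝ) (k : ℕ) (f : ℝ → ℝ) (Q0 : ℝ → ℝ → ℝ)
    (Qp Qm : ℕ → ℝ → ℝ → ℝ) (U : ℤ → ℝ) (j : ℤ) : ℝ :=
  (f (U j) + f (U (j + 1))) / 2
    - (1 / (2 * lam)) * Q0 (U j) (U (j + 1)) * (U (j + 1) - U j)
    - (1 / lam) * ∑ i ∈ Finset.Icc 1 (k - 1),
        (Qm i (U (j - (i : ℤ))) (U (j + 1 - (i : ℤ))) * (U (j + 1 - (i : ℤ)) - U (j - (i : ℤ))) +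
         Qp i (U (j + (i : ℤ))) (U (j + 1 + (i : ℤ))) * (U (j + 1 + (i : ℤ)) - U (j + (i : ℤ))))

/-- Update map `H(U)_j = U_j − λ(F_{j+1/2} − F_{j−1/2})` of the viscosity-form scheme. -/
noncomputable def viscH (lam : ℝ) (k : ℕ) (f : ℝ → ℝ) (Q0 : ℝ → ℝ → ℝ)
    (Qp Qm : ℕ → ℝ → ℝ → ℝ) (U : ℤ → ℝ) (j : ℤ) : ℝ :=
  U j - lam * (viscF lam k f Q0 Qp Qm U j - viscF lam k f Q0 Qp Qm U (j - 1))

/-- The step sequence equal to `uL` for `j ≤ p` and `uR` for `j > p`. -/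
noncomputable def stepSeq (p : ℤ) (uL uR : ℝ) : ℤ → ℝ := fun j => if j ≤ p then uL else uR

/-- A viscosity term evaluated on a step sequence is supported at the jump. -/
theorem stepSeq_viscosity_term (q : ℝ → ℝ → ℝ) (uL uR : ℝ) (p m n : ℤ) (hn : n = m + 1) :
    q (stepSeq p uL uR m) (stepSeq p uL uR n) * (stepSeq p uL uR n - stepSeq p uL uR m)
      = if m = p then q uL uR * (uR - uL) else 0 := by
  subst hn
  unfold stepSeq
  rcases lt_trichotomy m p with h | h | h
  · rw [if_pos (by omega : m + 1 ≤ p), if_pos h.le, if_neg h.ne]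
    ring
  · subst h
    simp
  · rw [if_neg (by omega : ¬ m + 1 ≤ p), if_neg (by omega : ¬ m ≤ p), if_neg h.ne']
    ring

/-- The numerical flux of a viscosity-form scheme on a step sequence. -/
theorem viscF_stepSeq (lam : ℝ) (k : ℕ) (f : ℝ → ℝ) (Q0 : ℝ → ℝ → ℝ)
    (Qp Qm : ℕ → ℝ → ℝ → ℝ) (uL uR : ℝ) (p j : ℤ) :
    viscF lam k f Q0 Qp Qm (stepSeq p uL uR) j
      = (f (stepSeq p uL uR j) + f (stepSeq p uL uR (j + 1))) / 2
        - 1 / (2 * lam) * (if j = p then Q0 uL uR * (uR - uL) else 0)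
        - 1 / lam * ∑ i ∈ Finset.Icc 1 (k - 1),
          ((if j - (i : ℤ) = p then Qm i uL uR * (uR - uL) else 0) +
            (if j + (i : ℤ) = p then Qp i uL uR * (uR - uL) else 0)) := by
  unfold viscF
  rw [mul_assoc, stepSeq_viscosity_term Q0 uL uR p j (j + 1) rfl]
  congr 2
  refine Finset.sum_congr rfl fun i _ => ?_
  rw [stepSeq_viscosity_term (Qm i) uL uR p (j - i) (j + 1 - i) (by ring),
    stepSeq_viscosity_term (Qp i) uL uR p (j + i) (j + 1 + i) (by ring)]

/-- The flux at the jump of a step sequence only involves the central coefficient. -/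
theorem viscF_stepSeq_self (lam : ℝ) (k : ℕ) (f : ℝ → ℝ) (Q0 : ℝ → ℝ → ℝ)
    (Qp Qm : ℕ → ℝ → ℝ → ℝ) (uL uR : ℝ) (p : ℤ) :
    viscF lam k f Q0 Qp Qm (stepSeq p uL uR) p
      = (f (stepSeq p uL uR p) + f (stepSeq p uL uR (p + 1))) / 2
        - 1 / (2 * lam) * (Q0 uL uR * (uR - uL)) := by
  rw [viscF_stepSeq, if_pos rfl, Finset.sum_eq_zero, mul_zero, sub_zero]
  intro i hi
  have := (Finset.mem_Icc.1 hi).1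
  rw [if_neg (by omega), if_neg (by omega), add_zero]

/-- The flux `n` cells to the right of the jump only involves the coefficient `Qm n`. -/
theorem viscF_stepSeq_add (lam : ℝ) (k : ℕ) (f : ℝ → ℝ) (Q0 : ℝ → ℝ → ℝ)
    (Qp Qm : ℕ → ℝ → ℝ → ℝ) (hQm : ∀ i, k ≤ i → ∀ a b : ℝ, Qm i a b = 0)
    (uL uR : ℝ) (p : ℤ) (n : ℕ) (hn : 1 ≤ n) :
    viscF lam k f Q0 Qp Qm (stepSeq p uL uR) (p + n)
      = (f (stepSeq p uL uR (p + n)) + f (stepSeq p uL uR (p + n + 1))) / 2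
        - 1 / lam * (Qm n uL uR * (uR - uL)) := by
  rw [viscF_stepSeq, if_neg (by omega), mul_zero, sub_zero, Finset.sum_eq_single n]
  · rw [if_pos (by omega), if_neg (by omega), add_zero]
  · intro i hi hin
    have := (Finset.mem_Icc.1 hi).1
    rw [if_neg (by omega), if_neg (by omega), add_zero]
  · intro h
    rw [Finset.mem_Icc] at h
    rw [if_neg (by omega : ¬ p + (n : ℤ) + n = p), hQm n (by omega)]
    simp

/-- The flux `n` cells to the left of the jump only involves the coefficient `Qp n`. -/
theorem viscF_stepSeq_sub (lam : ℝ) (k : ℕ) (f : ℝ → ℝ) (Q0 : ℝ → ℝ → ℝ)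
    (Qp Qm : ℕ → ℝ → ℝ → ℝ) (hQp : ∀ i, k ≤ i → ∀ a b : ℝ, Qp i a b = 0)
    (uL uR : ℝ) (p : ℤ) (n : ℕ) (hn : 1 ≤ n) :
    viscF lam k f Q0 Qp Qm (stepSeq p uL uR) (p - n)
      = (f (stepSeq p uL uR (p - n)) + f (stepSeq p uL uR (p - n + 1))) / 2
        - 1 / lam * (Qp n uL uR * (uR - uL)) := by
  rw [viscF_stepSeq, if_neg (by omega), mul_zero, sub_zero, Finset.sum_eq_single n]
  · rw [if_neg (by omega), if_pos (by omega), zero_add]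
  · intro i hi hin
    have := (Finset.mem_Icc.1 hi).1
    rw [if_neg (by omega), if_neg (by omega), add_zero]
  · intro h
    rw [Finset.mem_Icc] at h
    rw [if_neg (by omega : ¬ p - (n : ℤ) - n = p), hQp n (by omega)]
    simp

/-- Two integer sequences with equal increments that agree somewhere agree everywhere. -/
theorem eq_of_sub_pred_eq {F G : ℤ → ℝ} (h : ∀ j, F j - F (j - 1) = G j - G (j - 1))
    {a : ℤ} (ha : F a = G a) (j : ℤ) : F j = G j := by
  induction j using Int.inductionOn' (b := a) with
  | zero => exact ha
  | succ m _ ih =>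
    have := h (m + 1)
    rw [add_sub_cancel_right] at this
    linarith
  | pred m _ ih =>
    have := h m
    linarith

/-- If two local (2k+1)-point viscosity-form schemes for the same flux `f`
and mesh ratio `λ` (coefficients vanishing for `i ≥ k`) define the same update map on
every step sequence, then their viscosity coefficients agree at every pair `uL ≠ uR`. -/
theorem stmt_1 (k : ℕ) (hk : 1 ≤ k) (lam : ℝ) (hlam : 0 < lam)
    (f : ℝ → ℝ) (hf : Differentiable ℝ f)
    (Q0 Q0' : ℝ → ℝ → ℝ) (Qp Qm Qp' Qm' : ℕ → ℝ → ℝ → ℝ)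
    (hQp : ∀ i, k ≤ i → ∀ a b : ℝ, Qp i a b = 0)
    (hQm : ∀ i, k ≤ i → ∀ a b : ℝ, Qm i a b = 0)
    (hQp' : ∀ i, k ≤ i → ∀ a b : ℝ, Qp' i a b = 0)
    (hQm' : ∀ i, k ≤ i → ∀ a b : ℝ, Qm' i a b = 0)
    (hH : ∀ (p : ℤ) (uL uR : ℝ) (j : ℤ),
      viscH lam k f Q0 Qp Qm (stepSeq p uL uR) j = viscH lam k f Q0' Qp' Qm' (stepSeq p uL uR) j) :
    ∀ (uL uR : ℝ), uL ≠ uR →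
      Q0 uL uR = Q0' uL uR ∧
      ∀ i : ℕ, 1 ≤ i → Qp i uL uR = Qp' i uL uR ∧ Qm i uL uR = Qm' i uL uR := by
  intro uL uR hne
  have hd : uR - uL ≠ 0 := sub_ne_zero.2 hne.symm
  have hflux : ∀ j, viscF lam k f Q0 Qp Qm (stepSeq 0 uL uR) j
      = viscF lam k f Q0' Qp' Qm' (stepSeq 0 uL uR) j := by
    refine eq_of_sub_pred_eq (a := 0 + (k : ℤ)) (fun j => ?_) ?_
    · have := hH 0 uL uR j
      unfold viscH at this
      exact mul_left_cancel₀ hlam.ne' (sub_right_injective this)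
    · rw [viscF_stepSeq_add lam k f Q0 Qp Qm hQm uL uR 0 k hk,
        viscF_stepSeq_add lam k f Q0' Qp' Qm' hQm' uL uR 0 k hk,
        hQm k le_rfl, hQm' k le_rfl]
  have hlam_inv : 1 / lam ≠ 0 := one_div_ne_zero hlam.ne'
  refine ⟨?_, fun n hn => ⟨?_, ?_⟩⟩
  · have := hflux 0
    rw [viscF_stepSeq_self, viscF_stepSeq_self] at this
    exact mul_right_cancel₀ hd (mul_left_cancel₀
      (one_div_ne_zero (mul_ne_zero two_ne_zero hlam.ne')) (sub_right_injective this))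
  · have := hflux (0 - n)
    rw [viscF_stepSeq_sub lam k f Q0 Qp Qm hQp uL uR 0 n hn,
      viscF_stepSeq_sub lam k f Q0' Qp' Qm' hQp' uL uR 0 n hn] at this
    exact mul_right_cancel₀ hd (mul_left_cancel₀ hlam_inv (sub_right_injective this))
  · have := hflux (0 + n)
    rw [viscF_stepSeq_add lam k f Q0 Qp Qm hQm uL uR 0 n hn,
      viscF_stepSeq_add lam k f Q0' Qp' Qm' hQm' uL uR 0 n hn] at this
    exact mul_right_cancel₀ hd (mul_left_cancel₀ hlam_inv (sub_right_injective this))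
end

section
/- Assume the flux f : ℝ → ℝ and all viscosity coefficients Q^0, Q^{i+}, Q^{i−} : ℝ×ℝ → ℝ are differentiable, with Q^{i±} = 0 for i ≥ k. Let H : ℝ^{2k+1} → ℝ, H(U_{−k},…,U_k) = U_0 − λ(F_{1/2} − F_{−1/2}), be the viscosity-form update. Then at every diagonal point (u,…,u), writing Q̄^α = Q^α(u,u) and c = λ f'(u): (i) ∂H/∂U_{±ℓ} = Q̄^{(ℓ−1)±} − 2Q̄^{ℓ±} + Q̄^{(ℓ+1)±} for 2 ≤ ℓ ≤ k; (ii) ∂H/∂U_{±1} = ½(Q̄^0 ∓ c) − 2Q̄^{1±} + Q̄^{2±}; and consequently (iii) Σ_{ℓ=−k}^{k} ℓ² ∂H/∂U_ℓ(u,…,u) = Q̄^0 + 2 Σ_{i=1}^{k−1} (Q̄^{i+} + Q̄^{i−}). -/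
/-- The partial derivative `∂H/∂U_ℓ` of the update map, viewed as a function
`H(U_{−k},…,U_k)` of the `2k+1` cell values, evaluated at the diagonal point `(u,…,u)`:
it is the derivative at `t = 0` of `t ↦ H` applied to the sequence which equals `u`
everywhere except at position `ℓ`, where it equals `u + t`. -/
noncomputable def partialH (lam : ℝ) (k : ℕ) (f : ℝ → ℝ) (Q0 : ℝ → ℝ → ℝ)
    (Qp Qm : ℕ → ℝ → ℝ → ℝ) (u : ℝ) (ℓ : ℤ) : ℝ :=
  deriv (fun t : ℝ => viscH lam k f Q0 Qp Qm (fun j => if j = ℓ then u + t else u) 0) 0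

/-- The Kronecker delta on `ℤ` with real values. -/
def kron (a l : ℤ) : ℝ := if a = l then 1 else 0

/-- The second-difference sum `∑ q_i (δ_{i+1,l} - 2 δ_{i,l} + δ_{i-1,l})` over `1 ≤ i ≤ k - 1`. -/
def secondDiffSum (k : ℕ) (q : ℕ → ℝ) (l : ℤ) : ℝ :=
  ∑ i ∈ Finset.Icc 1 (k - 1),
    q i * (kron ((i : ℤ) + 1) l - 2 * kron (i : ℤ) l + kron ((i : ℤ) - 1) l)

theorem kron_neg (a l : ℤ) : kron a (-l) = kron (-a) l := by
  unfold kron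
  congr 1
  exact propext ⟨fun h => by lia, fun h => by lia⟩

theorem sum_mul_kron (s : Finset ℤ) (g : ℤ → ℝ) {a : ℤ} (ha : a ∈ s) :
    ∑ l ∈ s, g l * kron a l = g a := by
  simp [kron, ha]

theorem sum_Icc_mul_kron {k : ℕ} {q : ℕ → ℝ} (hq : ∀ i, k ≤ i → q i = 0)
    {m : ℕ} (hm : 1 ≤ m) {a l : ℤ} (h : l = m + a) :
    ∑ i ∈ Finset.Icc 1 (k - 1), q i * kron ((i : ℤ) + a) l = q m := by
  rw [Finset.sum_eq_single m]
  · simp [kron, h]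
  · intro i _ him
    have : (i : ℤ) + a ≠ l := by lia
    simp [kron, this]
  · intro hmem
    rw [hq m (by simp only [Finset.mem_Icc] at hmem; lia), zero_mul]

theorem sum_Icc_mul_kron_of_le (k : ℕ) (q : ℕ → ℝ) {a l : ℤ} (h : l ≤ a) :
    ∑ i ∈ Finset.Icc 1 (k - 1), q i * kron ((i : ℤ) + a) l = 0 := by
  refine Finset.sum_eq_zero fun i hi => ?_
  have : (i : ℤ) + a ≠ l := by
    simp only [Finset.mem_Icc] at hi
    lia
  simp [kron, this]

theorem secondDiffSum_eq (k : ℕ) (q : ℕ → ℝ) (l : ℤ) :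
    secondDiffSum k q l =
      ∑ i ∈ Finset.Icc 1 (k - 1), q i * kron ((i : ℤ) + 1) l
        - 2 * ∑ i ∈ Finset.Icc 1 (k - 1), q i * kron ((i : ℤ) + 0) l
        + ∑ i ∈ Finset.Icc 1 (k - 1), q i * kron ((i : ℤ) + (-1)) l := by
  rw [secondDiffSum, Finset.mul_sum, ← Finset.sum_sub_distrib, ← Finset.sum_add_distrib]
  refine Finset.sum_congr rfl fun i _ => ?_
  rw [add_zero, ← sub_eq_add_neg]
  ring

theorem secondDiffSum_of_two_le {k : ℕ} {q : ℕ → ℝ} (hq : ∀ i, k ≤ i → q i = 0)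
    {m : ℕ} (hm : 2 ≤ m) :
    secondDiffSum k q m = q (m - 1) - 2 * q m + q (m + 1) := by
  rw [secondDiffSum_eq, sum_Icc_mul_kron hq (m := m - 1) (by lia) (by lia),
    sum_Icc_mul_kron hq (m := m) (by lia) (by lia),
    sum_Icc_mul_kron hq (m := m + 1) (by lia) (by lia)]

theorem secondDiffSum_one {k : ℕ} {q : ℕ → ℝ} (hq : ∀ i, k ≤ i → q i = 0) :
    secondDiffSum k q 1 = -2 * q 1 + q 2 := by
  rw [secondDiffSum_eq, sum_Icc_mul_kron_of_le k q (by lia),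
    sum_Icc_mul_kron hq (m := 1) (by lia) (by lia),
    sum_Icc_mul_kron hq (m := 2) (by lia) (by lia)]
  ring

theorem secondDiffSum_of_neg (k : ℕ) (q : ℕ → ℝ) {l : ℤ} (hl : l < 0) :
    secondDiffSum k q l = 0 := by
  rw [secondDiffSum_eq, sum_Icc_mul_kron_of_le k q (by lia),
    sum_Icc_mul_kron_of_le k q (by lia), sum_Icc_mul_kron_of_le k q (by lia)]
  ring

theorem sum_sq_mul_secondDiffSum (k : ℕ) (q : ℕ → ℝ) :
    ∑ l ∈ Finset.Icc (-(k : ℤ)) (k : ℤ), (l : ℝ) ^ 2 * secondDiffSum k q l =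
      2 * ∑ i ∈ Finset.Icc 1 (k - 1), q i := by
  simp only [secondDiffSum, Finset.mul_sum]
  rw [Finset.sum_comm]
  refine Finset.sum_congr rfl fun i hi => ?_
  simp only [Finset.mem_Icc] at hi
  have key (a : ℤ) (h₁ : -(k : ℤ) ≤ a) (h₂ : a ≤ k) :=
    sum_mul_kron (Finset.Icc (-(k : ℤ)) (k : ℤ)) (fun l => (l : ℝ) ^ 2)
      (Finset.mem_Icc.2 ⟨h₁, h₂⟩)
  calc
    _ = q i * (∑ l ∈ Finset.Icc (-(k : ℤ)) (k : ℤ), (l : ℝ) ^ 2 * kron ((i : ℤ) + 1) l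
          - 2 * ∑ l ∈ Finset.Icc (-(k : ℤ)) (k : ℤ), (l : ℝ) ^ 2 * kron (i : ℤ) l
          + ∑ l ∈ Finset.Icc (-(k : ℤ)) (k : ℤ), (l : ℝ) ^ 2 * kron ((i : ℤ) - 1) l) := by
      rw [Finset.mul_sum, ← Finset.sum_sub_distrib, ← Finset.sum_add_distrib, Finset.mul_sum]
      exact Finset.sum_congr rfl fun l _ => by ring
    _ = 2 * q i := by
      rw [key _ (by lia) (by lia), key _ (by lia) (by lia), key _ (by lia) (by lia)]
      push_cast
      ring

theorem sum_sq_mul_secondDiffSum_neg (k : ℕ) (q : ℕ → ℝ) :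
    ∑ l ∈ Finset.Icc (-(k : ℤ)) (k : ℤ), (l : ℝ) ^ 2 * secondDiffSum k q (-l) =
      2 * ∑ i ∈ Finset.Icc 1 (k - 1), q i := by
  rw [← sum_sq_mul_secondDiffSum]
  refine Finset.sum_bij' (fun l _ => -l) (fun l _ => -l) ?_ ?_ ?_ ?_ ?_ <;> intro l hl
  · simp only [Finset.mem_Icc] at hl ⊢
    lia
  · simp only [Finset.mem_Icc] at hl ⊢
    lia
  · simp
  · simp
  · simp

theorem hasDerivAt_perturb (u : ℝ) (l j : ℤ) :
    HasDerivAt (fun t : ℝ => if j = l then u + t else u) (kron j l) 0 := by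
  by_cases h : j = l
  · simpa [h, kron] using (hasDerivAt_id (0 : ℝ)).const_add u
  · simpa [h, kron] using hasDerivAt_const (0 : ℝ) u

theorem hasDerivAt_comp_perturb {f : ℝ → ℝ} (hf : Differentiable ℝ f) (u : ℝ) (l j : ℤ) :
    HasDerivAt (fun t : ℝ => f (if j = l then u + t else u)) (deriv f u * kron j l) 0 := by
  have h : HasDerivAt f (deriv f u) (if j = l then u + 0 else u) := by
    simpa using (hf u).hasDerivAt
  exact h.comp (0 : ℝ) (hasDerivAt_perturb u l j)

theorem hasDerivAt_visc_term {Q : ℝ → ℝ → ℝ}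
    (hQ : Differentiable ℝ (fun p : ℝ × ℝ => Q p.1 p.2)) (u : ℝ) (l a b : ℤ) :
    HasDerivAt (fun t : ℝ => Q (if a = l then u + t else u) (if b = l then u + t else u) *
        ((if b = l then u + t else u) - (if a = l then u + t else u)))
      (Q u u * (kron b l - kron a l)) 0 := by
  have ha := hasDerivAt_perturb u l a
  have hb := hasDerivAt_perturb u l b
  have hd : DifferentiableAt ℝ
      (fun t : ℝ => Q (if a = l then u + t else u) (if b = l then u + t else u)) 0 :=
    DifferentiableAt.comp (0 : ℝ) (hQ _) (ha.differentiableAt.prodMk hb.differentiableAt)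
  refine (hd.hasDerivAt.mul (hb.sub ha)).congr_deriv ?_
  simp

theorem hasDerivAt_viscF (lam : ℝ) (k : ℕ) {f : ℝ → ℝ} (hf : Differentiable ℝ f)
    {Q0 : ℝ → ℝ → ℝ} {Qp Qm : ℕ → ℝ → ℝ → ℝ}
    (hQ0d : Differentiable ℝ (fun p : ℝ × ℝ => Q0 p.1 p.2))
    (hQpd : ∀ i, Differentiable ℝ (fun p : ℝ × ℝ => Qp i p.1 p.2))
    (hQmd : ∀ i, Differentiable ℝ (fun p : ℝ × ℝ => Qm i p.1 p.2)) (u : ℝ) (l j : ℤ) :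
    HasDerivAt (fun t : ℝ => viscF lam k f Q0 Qp Qm (fun j => if j = l then u + t else u) j)
      ((deriv f u * kron j l + deriv f u * kron (j + 1) l) / 2
        - (1 / (2 * lam)) * (Q0 u u * (kron (j + 1) l - kron j l))
        - (1 / lam) * ∑ i ∈ Finset.Icc 1 (k - 1),
            (Qm i u u * (kron (j + 1 - (i : ℤ)) l - kron (j - (i : ℤ)) l) +
             Qp i u u * (kron (j + 1 + (i : ℤ)) l - kron (j + (i : ℤ)) l))) 0 := by
  unfold viscF
  simp only [mul_assoc (1 / (2 * lam))]
  refine ((((hasDerivAt_comp_perturb hf u l j).add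
    (hasDerivAt_comp_perturb hf u l (j + 1))).div_const 2).sub
    ((hasDerivAt_visc_term hQ0d u l j (j + 1)).const_mul _)).sub
    (HasDerivAt.const_mul _ (HasDerivAt.fun_sum fun i _ => ?_))
  exact (hasDerivAt_visc_term (hQmd i) u l _ _).add (hasDerivAt_visc_term (hQpd i) u l _ _)

theorem partialH_eq (k : ℕ) {lam : ℝ} (hlam : lam ≠ 0) {f : ℝ → ℝ} (hf : Differentiable ℝ f)
    {Q0 : ℝ → ℝ → ℝ} {Qp Qm : ℕ → ℝ → ℝ → ℝ}
    (hQ0d : Differentiable ℝ (fun p : ℝ × ℝ => Q0 p.1 p.2))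
    (hQpd : ∀ i, Differentiable ℝ (fun p : ℝ × ℝ => Qp i p.1 p.2))
    (hQmd : ∀ i, Differentiable ℝ (fun p : ℝ × ℝ => Qm i p.1 p.2)) (u : ℝ) (l : ℤ) :
    partialH lam k f Q0 Qp Qm u l =
      (1 - Q0 u u) * kron 0 l + (Q0 u u - lam * deriv f u) / 2 * kron 1 l
        + (Q0 u u + lam * deriv f u) / 2 * kron (-1) l
        + secondDiffSum k (fun i => Qp i u u) l + secondDiffSum k (fun i => Qm i u u) (-l) := by
  have hF := hasDerivAt_viscF lam k hf hQ0d hQpd hQmd u l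
  have hH := (hasDerivAt_perturb u l 0).sub (((hF 0).sub (hF (0 - 1))).const_mul lam)
  refine hH.deriv.trans ?_
  have hsum : secondDiffSum k (fun i => Qp i u u) l + secondDiffSum k (fun i => Qm i u u) (-l) =
      ∑ i ∈ Finset.Icc 1 (k - 1),
            (Qm i u u * (kron (0 + 1 - (i : ℤ)) l - kron (0 - (i : ℤ)) l) +
             Qp i u u * (kron (0 + 1 + (i : ℤ)) l - kron (0 + (i : ℤ)) l))
      - ∑ i ∈ Finset.Icc 1 (k - 1),
            (Qm i u u * (kron (0 - 1 + 1 - (i : ℤ)) l - kron (0 - 1 - (i : ℤ)) l) +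
             Qp i u u * (kron (0 - 1 + 1 + (i : ℤ)) l - kron (0 - 1 + (i : ℤ)) l)) := by
    rw [secondDiffSum, secondDiffSum, ← Finset.sum_add_distrib, ← Finset.sum_sub_distrib]
    refine Finset.sum_congr rfl fun i _ => ?_
    simp only [kron_neg]
    rw [show -((i : ℤ) + 1) = 0 - 1 - i by ring, show -((i : ℤ) - 1) = 0 + 1 - i by ring,
      show (0 : ℤ) - 1 + 1 - i = -i by ring, show (0 : ℤ) - i = -i by ring,
      show (0 : ℤ) + 1 + i = i + 1 by ring, show (0 : ℤ) - 1 + 1 + i = i by ring,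
      show (0 : ℤ) + i = i by ring, show (0 : ℤ) - 1 + i = i - 1 by ring]
    ring
  rw [add_assoc _ (secondDiffSum _ _ _), hsum]
  rw [show (0 : ℤ) - 1 + 1 = 0 by ring, show (0 : ℤ) + 1 = 1 by ring,
    show (0 : ℤ) - 1 = -1 by ring]
  field_simp
  ring


/-- Partial derivatives of the viscosity-form update at a diagonal point
`(u,…,u)`, with `Q̄^α = Q^α(u,u)` and `c = λ f'(u)`:
(i) `∂H/∂U_{±ℓ} = Q̄^{(ℓ−1)±} − 2Q̄^{ℓ±} + Q̄^{(ℓ+1)±}` for `2 ≤ ℓ ≤ k`;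
(ii) `∂H/∂U_{±1} = ½(Q̄^0 ∓ c) − 2Q̄^{1±} + Q̄^{2±}`;
(iii) `Σ_{ℓ=−k}^{k} ℓ² ∂H/∂U_ℓ = Q̄^0 + 2 Σ_{i=1}^{k−1} (Q̄^{i+} + Q̄^{i−})`. -/
theorem stmt_3 (k : ℕ) (hk : 1 ≤ k) (lam : ℝ) (hlam : 0 < lam)
    (f : ℝ → ℝ) (hf : Differentiable ℝ f)
    (Q0 : ℝ → ℝ → ℝ) (Qp Qm : ℕ → ℝ → ℝ → ℝ)
    (hQ0d : Differentiable ℝ (fun p : ℝ × ℝ => Q0 p.1 p.2))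
    (hQpd : ∀ i, Differentiable ℝ (fun p : ℝ × ℝ => Qp i p.1 p.2))
    (hQmd : ∀ i, Differentiable ℝ (fun p : ℝ × ℝ => Qm i p.1 p.2))
    (hQp : ∀ i, k ≤ i → ∀ a b : ℝ, Qp i a b = 0)
    (hQm : ∀ i, k ≤ i → ∀ a b : ℝ, Qm i a b = 0)
    (u : ℝ) :
    (∀ ℓ : ℕ, 2 ≤ ℓ → ℓ ≤ k →
      partialH lam k f Q0 Qp Qm u (ℓ : ℤ) =
        Qp (ℓ - 1) u u - 2 * Qp ℓ u u + Qp (ℓ + 1) u u ∧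
      partialH lam k f Q0 Qp Qm u (-(ℓ : ℤ)) =
        Qm (ℓ - 1) u u - 2 * Qm ℓ u u + Qm (ℓ + 1) u u) ∧
    (partialH lam k f Q0 Qp Qm u 1 =
        (Q0 u u - lam * deriv f u) / 2 - 2 * Qp 1 u u + Qp 2 u u ∧
     partialH lam k f Q0 Qp Qm u (-1) =
        (Q0 u u + lam * deriv f u) / 2 - 2 * Qm 1 u u + Qm 2 u u) ∧
    (∑ ℓ ∈ Finset.Icc (-(k : ℤ)) (k : ℤ), (ℓ : ℝ) ^ 2 * partialH lam k f Q0 Qp Qm u ℓ =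
      Q0 u u + 2 * ∑ i ∈ Finset.Icc 1 (k - 1), (Qp i u u + Qm i u u)) := by
  have hH := partialH_eq k hlam.ne' hf hQ0d hQpd hQmd u
  have hp : ∀ i, k ≤ i → (fun i => Qp i u u) i = 0 := fun i hi => hQp i hi u u
  have hm : ∀ i, k ≤ i → (fun i => Qm i u u) i = 0 := fun i hi => hQm i hi u u
  refine ⟨fun ℓ hℓ _ => ⟨?_, ?_⟩, ⟨?_, ?_⟩, ?_⟩
  · have h0 : (0 : ℤ) ≠ ℓ := by lia
    have h1 : (1 : ℤ) ≠ ℓ := by lia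
    have h2 : (-1 : ℤ) ≠ ℓ := by lia
    rw [hH, secondDiffSum_of_two_le hp hℓ, secondDiffSum_of_neg k _ (by lia)]
    simp only [kron, if_neg h0, if_neg h1, if_neg h2]
    ring
  · have h0 : (0 : ℤ) ≠ -ℓ := by lia
    have h1 : (1 : ℤ) ≠ -ℓ := by lia
    have h2 : (-1 : ℤ) ≠ -ℓ := by lia
    rw [hH, neg_neg, secondDiffSum_of_two_le hm hℓ, secondDiffSum_of_neg k _ (by lia)]
    simp only [kron, if_neg h0, if_neg h1, if_neg h2]
    ring
  · rw [hH, secondDiffSum_one hp, secondDiffSum_of_neg k _ (by lia)]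
    norm_num [kron]
    ring
  · rw [hH, neg_neg, secondDiffSum_one hm, secondDiffSum_of_neg k _ (by lia)]
    norm_num [kron]
    ring
  · have key (a : ℤ) (h₁ : -(k : ℤ) ≤ a) (h₂ : a ≤ k) (x : ℝ) :=
      sum_mul_kron (Finset.Icc (-(k : ℤ)) (k : ℤ)) (fun l => (l : ℝ) ^ 2 * x)
        (Finset.mem_Icc.2 ⟨h₁, h₂⟩)
    simp only [hH, mul_add, Finset.sum_add_distrib, ← mul_assoc]
    rw [key 0 (by lia) (by lia), key 1 (by lia) (by lia), key (-1) (by lia) (by lia),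
      sum_sq_mul_secondDiffSum, sum_sq_mul_secondDiffSum_neg]
    push_cast
    ring
end

section
/- A local (2k+1)-point flux-difference splitting scheme is unconditionally TVD if and only if for every pair (u_L, u_R) with u_L ≠ u_R the following inequalities hold: 1/λ − 𝒜^{0+}(u_L,u_R) + 𝒜^{0−}(u_L,u_R) ≥ 0; 𝒜^{i+}(u_L,u_R) − 𝒜^{(i+1)+}(u_L,u_R) ≥ 0 for all i ≥ 0; and 𝒜^{(i+1)−}(u_L,u_R) − 𝒜^{i−}(u_L,u_R) ≥ 0 for all i ≥ 0. -/
/-- The update map of a local (2k+1)-point flux-difference splitting scheme. -/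
noncomputable def fdsH (lam : ℝ) (k : ℕ) (Ap Am : ℕ → ℝ → ℝ → ℝ) (U : ℤ → ℝ) (j : ℤ) : ℝ :=
  U j - lam * ∑ i ∈ Finset.range k,
    (Ap i (U (j - 1 - (i : ℤ))) (U (j - (i : ℤ))) * (U (j - (i : ℤ)) - U (j - 1 - (i : ℤ))) +
     Am i (U (j + (i : ℤ))) (U (j + 1 + (i : ℤ))) * (U (j + 1 + (i : ℤ)) - U (j + (i : ℤ))))

/-- Each difference of the updated sequence is a combination of the differences of `U`
whose coefficients are exactly the quantities of the TVD criterion. -/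
theorem fdsH_succ_sub (lam : ℝ) (k : ℕ) (Ap Am : ℕ → ℝ → ℝ → ℝ)
    (hAp : ∀ i, k ≤ i → ∀ a b : ℝ, Ap i a b = 0)
    (hAm : ∀ i, k ≤ i → ∀ a b : ℝ, Am i a b = 0) (U : ℤ → ℝ) (j : ℤ) :
    fdsH lam k Ap Am U (j + 1) - fdsH lam k Ap Am U j =
      (1 - lam * Ap 0 (U j) (U (j + 1)) + lam * Am 0 (U j) (U (j + 1))) * (U (j + 1) - U j) +
      ∑ i ∈ Finset.range k,
        (lam * (Ap i (U (j - (1 + i))) (U (j - (1 + i) + 1)) -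
            Ap (i + 1) (U (j - (1 + i))) (U (j - (1 + i) + 1))) *
            (U (j - (1 + i) + 1) - U (j - (1 + i))) +
          lam * (Am (i + 1) (U (j + (1 + i))) (U (j + (1 + i) + 1)) -
            Am i (U (j + (1 + i))) (U (j + (1 + i) + 1))) *
            (U (j + (1 + i) + 1) - U (j + (1 + i)))) := by
  set a : ℕ → ℤ → ℝ := fun i m => Ap i (U m) (U (m + 1)) * (U (m + 1) - U m) with ha
  set b : ℕ → ℤ → ℝ := fun i m => Am i (U m) (U (m + 1)) * (U (m + 1) - U m) with hb
  have hH : ∀ j : ℤ, fdsH lam k Ap Am U j = U j - lam *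
      (∑ i ∈ Finset.range k, a i (j - (1 + i)) + ∑ i ∈ Finset.range k, b i (j + i)) := by
    intro j
    rw [fdsH, ← Finset.sum_add_distrib]
    congr 2
    refine Finset.sum_congr rfl fun i _ => ?_
    have h1 : j - 1 - (i : ℤ) = j - (1 + i) := by ring
    have h2 : j - (i : ℤ) = j - (1 + i) + 1 := by ring
    have h3 : j + 1 + (i : ℤ) = j + i + 1 := by ring
    rw [h1, h2, h3]
  have hak : ∀ m, a k m = 0 := fun m => by simp [ha, hAp k le_rfl]
  have hbk : ∀ m, b k m = 0 := fun m => by simp [hb, hAm k le_rfl]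
  have hA : ∑ i ∈ Finset.range k, a i (j + 1 - (1 + i)) =
      a 0 j + ∑ i ∈ Finset.range k, a (i + 1) (j - (1 + i)) := by
    have h := Finset.sum_range_succ (fun i : ℕ => a i (j + 1 - (1 + i))) k
    rw [Finset.sum_range_succ', hak, add_zero] at h
    rw [← h, add_comm]
    congr 1
    · congr 1; simp
    · refine Finset.sum_congr rfl fun i _ => ?_
      congr 1; push_cast; ring
  have hB : ∑ i ∈ Finset.range k, b i (j + i) =
      b 0 j + ∑ i ∈ Finset.range k, b (i + 1) (j + (1 + i)) := by
    have h := Finset.sum_range_succ (fun i : ℕ => b i (j + i)) k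
    rw [Finset.sum_range_succ', hbk, add_zero] at h
    rw [← h, add_comm]
    congr 1
    · congr 1; simp
    · refine Finset.sum_congr rfl fun i _ => ?_
      congr 1; push_cast; ring
  have hB' : ∑ i ∈ Finset.range k, b i (j + 1 + i) =
      ∑ i ∈ Finset.range k, b i (j + (1 + i)) := by
    simp only [add_assoc]
  have hR : ∑ i ∈ Finset.range k,
        (lam * (Ap i (U (j - (1 + i))) (U (j - (1 + i) + 1)) -
            Ap (i + 1) (U (j - (1 + i))) (U (j - (1 + i) + 1))) *
            (U (j - (1 + i) + 1) - U (j - (1 + i))) +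
          lam * (Am (i + 1) (U (j + (1 + i))) (U (j + (1 + i) + 1)) -
            Am i (U (j + (1 + i))) (U (j + (1 + i) + 1))) *
            (U (j + (1 + i) + 1) - U (j + (1 + i)))) =
      lam * (∑ i ∈ Finset.range k, a i (j - (1 + i)) -
        ∑ i ∈ Finset.range k, a (i + 1) (j - (1 + i)) +
        (∑ i ∈ Finset.range k, b (i + 1) (j + (1 + i)) -
        ∑ i ∈ Finset.range k, b i (j + (1 + i)))) := by
    rw [← Finset.sum_sub_distrib, ← Finset.sum_sub_distrib, ← Finset.sum_add_distrib,
      Finset.mul_sum]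
    refine Finset.sum_congr rfl fun i _ => ?_
    simp only [ha, hb]
    ring
  rw [hR, hH, hH, hA, hB, hB']
  simp only [ha, hb]
  ring

/-- The sum of the absolute values of combinations of translates is at most the sum of the
absolute values of the pieces. -/
theorem summable_abs_and_tsum_abs_le_of_translates (k : ℕ) (x c : ℤ → ℝ) (p q : ℕ → ℤ → ℝ)
    (hc : c.support.Finite) (hp : ∀ i, (p i).support.Finite) (hq : ∀ i, (q i).support.Finite)
    (hx : ∀ j, x j = c j + ∑ i ∈ Finset.range k, (p i (j - (1 + i)) + q i (j + (1 + i)))) :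
    Summable (fun j => |x j|) ∧
      ∑' j, |x j| ≤ ∑' j, (|c j| + ∑ i ∈ Finset.range k, (|p i j| + |q i j|)) := by
  have hs : ∀ f : ℤ → ℝ, f.support.Finite → Summable fun j => |f j| := fun f hf =>
    (summable_of_hasFiniteSupport hf).abs
  have hC := (hs c hc).hasSum
  have hP := fun i => (hs _ (hp i)).hasSum
  have hQ := fun i => (hs _ (hq i)).hasSum
  have hG := hC.add (hasSum_sum fun i (_ : i ∈ Finset.range k) => (hP i).add (hQ i))
  have hT := hC.add (hasSum_sum fun i (_ : i ∈ Finset.range k) =>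
    ((Equiv.subRight (1 + (i : ℤ))).hasSum_iff.mpr (hP i)).add
      ((Equiv.addRight (1 + (i : ℤ))).hasSum_iff.mpr (hQ i)))
  have hle : ∀ j, |x j| ≤ |c j| + ∑ i ∈ Finset.range k,
      (|p i (j - (1 + i))| + |q i (j + (1 + i))|) := by
    intro j
    rw [hx]
    refine (abs_add_le _ _).trans (add_le_add le_rfl ?_)
    exact (Finset.abs_sum_le_sum_abs _ _).trans
      (Finset.sum_le_sum fun i _ => abs_add_le _ _)
  have hsum : Summable fun j => |x j| :=
    Summable.of_nonneg_of_le (fun j => abs_nonneg _) hle hT.summable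
  exact ⟨hsum, (hasSum_le hle hsum.hasSum hT).trans_eq hG.tsum_eq.symm⟩

/-- The set of indices of nonzero differences is finite for eventually constant sequences. -/
theorem finite_support_mul_succ_sub (U f : ℤ → ℝ)
    (hU : ∃ (s : Finset ℤ) (c : ℝ), ∀ j ∉ s, U j = c) :
    (fun j => f j * (U (j + 1) - U j)).support.Finite := by
  obtain ⟨s, c, hs⟩ := hU
  refine ((s ∪ s.image fun j => j - 1).finite_toSet).subset fun j hj => ?_
  by_contra hn
  simp only [Finset.coe_union, Set.mem_union, Finset.mem_coe, Finset.mem_image, not_or,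
    not_exists, not_and] at hn
  refine hj ?_
  have h1 : j + 1 ∉ s := fun h => hn.2 _ h (by ring)
  simp [hs _ hn.1, hs _ h1]

/-- Total variation estimate for the updated sequence. -/
theorem fdsH_summable_and_tsum_le (lam : ℝ) (k : ℕ) (Ap Am : ℕ → ℝ → ℝ → ℝ)
    (hAp : ∀ i, k ≤ i → ∀ a b : ℝ, Ap i a b = 0)
    (hAm : ∀ i, k ≤ i → ∀ a b : ℝ, Am i a b = 0) (U : ℤ → ℝ)
    (hU : ∃ (s : Finset ℤ) (c : ℝ), ∀ j ∉ s, U j = c) :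
    Summable (fun j => |fdsH lam k Ap Am U (j + 1) - fdsH lam k Ap Am U j|) ∧
    ∑' j, |fdsH lam k Ap Am U (j + 1) - fdsH lam k Ap Am U j| ≤
      ∑' j, (|(1 - lam * Ap 0 (U j) (U (j + 1)) + lam * Am 0 (U j) (U (j + 1))) *
          (U (j + 1) - U j)| +
        ∑ i ∈ Finset.range k,
          (|lam * (Ap i (U j) (U (j + 1)) - Ap (i + 1) (U j) (U (j + 1))) *
            (U (j + 1) - U j)| +
          |lam * (Am (i + 1) (U j) (U (j + 1)) - Am i (U j) (U (j + 1))) *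
            (U (j + 1) - U j)|)) :=
  summable_abs_and_tsum_abs_le_of_translates k _ _
    (fun i j => lam * (Ap i (U j) (U (j + 1)) - Ap (i + 1) (U j) (U (j + 1))) *
      (U (j + 1) - U j))
    (fun i j => lam * (Am (i + 1) (U j) (U (j + 1)) - Am i (U j) (U (j + 1))) *
      (U (j + 1) - U j))
    (finite_support_mul_succ_sub U _ hU) (fun _ => finite_support_mul_succ_sub U _ hU)
    (fun _ => finite_support_mul_succ_sub U _ hU)
    (fdsH_succ_sub lam k Ap Am hAp hAm U)

/-- Equality in the triangle inequality forces all terms to share the sign of the sum. -/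
theorem mul_sum_nonneg_of_sum_abs_le {ι : Type*} (s : Finset ι) (x : ι → ℝ)
    (h : ∑ i ∈ s, |x i| ≤ |∑ i ∈ s, x i|) {i : ι} (hi : i ∈ s) :
    0 ≤ x i * ∑ j ∈ s, x j := by
  rcases le_total 0 (∑ j ∈ s, x j) with hS | hS
  · rw [abs_of_nonneg hS] at h
    have h0 := Finset.single_le_sum (f := fun j => |x j| - x j)
      (fun j _ => sub_nonneg.mpr (le_abs_self _)) hi
    rw [Finset.sum_sub_distrib] at h0
    have := abs_nonneg (x i)
    exact mul_nonneg (by linarith) hS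
  · rw [abs_of_nonpos hS] at h
    have h0 := Finset.single_le_sum (f := fun j => |x j| + x j)
      (fun j _ => by linarith [neg_abs_le (x j)]) hi
    rw [Finset.sum_add_distrib] at h0
    have := abs_nonneg (x i)
    exact mul_nonneg_of_nonpos_of_nonpos (by linarith) hS

/-- The update fixes values around which `U` is locally constant. -/
theorem fdsH_eq_of_locally_const (lam : ℝ) (k : ℕ) (Ap Am : ℕ → ℝ → ℝ → ℝ) (U : ℤ → ℝ)
    (j : ℤ) (c : ℝ) (h : ∀ m, j - k ≤ m → m ≤ j + k → U m = c) :
    fdsH lam k Ap Am U j = c := by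
  have h0 : ∀ i ∈ Finset.range k,
    (Ap i (U (j - 1 - (i : ℤ))) (U (j - (i : ℤ))) * (U (j - (i : ℤ)) - U (j - 1 - (i : ℤ))) +
     Am i (U (j + (i : ℤ))) (U (j + 1 + (i : ℤ))) *
      (U (j + 1 + (i : ℤ)) - U (j + (i : ℤ)))) = 0 := by
    intro i hi
    have := Finset.mem_range.mp hi
    rw [h (j - i) (by omega) (by omega), h (j - 1 - i) (by omega) (by omega),
      h (j + i) (by omega) (by omega), h (j + 1 + i) (by omega) (by omega)]
    simp
  rw [fdsH, Finset.sum_eq_zero h0, h j (by omega) (by omega)]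
  simp

/-- For a TVD scheme, the update of a wide rectangular pulse is monotone near its first jump. -/
theorem fdsH_pulse_mul_nonneg (k : ℕ) (lam : ℝ) (Ap Am : ℕ → ℝ → ℝ → ℝ)
    (hAp : ∀ i, k ≤ i → ∀ a b : ℝ, Ap i a b = 0)
    (hAm : ∀ i, k ≤ i → ∀ a b : ℝ, Am i a b = 0) (uL uR : ℝ) (U : ℤ → ℝ)
    (hUR : ∀ m : ℤ, k + 1 < m → m ≤ 3 * k + 3 → U m = uR)
    (hUl : ∀ m : ℤ, m ≤ k + 1 → U m = uL) (hUr : ∀ m : ℤ, 3 * k + 3 < m → U m = uL)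
    (hTV : (∃ (s : Finset ℤ) (c : ℝ), ∀ j ∉ s, U j = c) →
      ∑' j : ℤ, |fdsH lam k Ap Am U (j + 1) - fdsH lam k Ap Am U j| ≤
        ∑' j : ℤ, |U (j + 1) - U j|) (n : ℕ) (hn : n < 2 * k + 2) :
    0 ≤ (fdsH lam k Ap Am U (n + 1) - fdsH lam k Ap Am U n) * (uR - uL) := by
  have hU : ∃ (s : Finset ℤ) (c : ℝ), ∀ j ∉ s, U j = c := by
    refine ⟨Finset.Ioc (k + 1) (3 * k + 3), uL, fun j hj => ?_⟩
    rw [Finset.mem_Ioc] at hj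
    by_cases h : j ≤ k + 1
    · exact hUl j h
    · exact hUr j (by omega)
  have hD : ∑' j : ℤ, |U (j + 1) - U j| = 2 * |uR - uL| := by
    rw [tsum_eq_sum (s := {(k + 1 : ℤ), (3 * k + 3 : ℤ)})]
    · rw [Finset.sum_pair (by omega), hUl (k + 1) le_rfl, hUR (k + 1 + 1) (by omega) (by omega),
        hUR (3 * k + 3) (by omega) (by omega), hUr (3 * k + 3 + 1) (by omega),
        abs_sub_comm uL uR]
      ring
    · intro j hj
      simp only [Finset.mem_insert, Finset.mem_singleton, not_or] at hj
      rw [abs_eq_zero, sub_eq_zero]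
      by_cases h1 : j ≤ k
      · rw [hUl _ (by omega), hUl _ (by omega)]
      · by_cases h2 : j < 3 * k + 3
        · rw [hUR _ (by omega) (by omega), hUR _ (by omega) (by omega)]
        · rw [hUr _ (by omega), hUr _ (by omega)]
  have hsum := (fdsH_summable_and_tsum_le lam k Ap Am hAp hAm U hU).1
  set x : ℕ → ℝ := fun n => fdsH lam k Ap Am U n with hx
  have hfin : ∑ n ∈ Finset.range (2 * k + 2 + (2 * k + 2)), |x (n + 1) - x n| ≤
      2 * |uR - uL| := by
    have h := hsum.sum_le_tsum ((Finset.range (2 * k + 2 + (2 * k + 2))).map Nat.castEmbedding)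
      (fun _ _ => abs_nonneg _)
    rw [Finset.sum_map] at h
    simpa [hx] using h.trans ((hTV hU).trans_eq hD)
  have hx0 : x 0 = uL :=
    fdsH_eq_of_locally_const lam k Ap Am U _ _ fun m _ _ => hUl _ (by push_cast at *; omega)
  have hx1 : x (2 * k + 2) = uR :=
    fdsH_eq_of_locally_const lam k Ap Am U _ _ fun m _ _ =>
      hUR _ (by push_cast at *; omega) (by push_cast at *; omega)
  have hx2 : x (2 * k + 2 + (2 * k + 2)) = uL :=
    fdsH_eq_of_locally_const lam k Ap Am U _ _ fun m _ _ => hUr _ (by push_cast at *; omega)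
  rw [Finset.sum_range_add] at hfin
  have hright : |uR - uL| ≤ ∑ i ∈ Finset.range (2 * k + 2),
      |x (2 * k + 2 + i + 1) - x (2 * k + 2 + i)| := by
    have h := Finset.abs_sum_le_sum_abs (fun i => x (2 * k + 2 + i + 1) - x (2 * k + 2 + i))
      (Finset.range (2 * k + 2))
    have ht := Finset.sum_range_sub (fun i => x (2 * k + 2 + i)) (2 * k + 2)
    simp only [← add_assoc (2 * k + 2), add_zero] at ht
    rw [ht] at h
    rw [← add_assoc] at hx2
    rw [hx2, hx1, abs_sub_comm] at h
    exact h
  have hleft := Finset.sum_range_sub x (2 * k + 2)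
  rw [hx0, hx1] at hleft
  have h := mul_sum_nonneg_of_sum_abs_le (Finset.range (2 * k + 2)) (fun n => x (n + 1) - x n)
    (by rw [hleft]; linarith) (Finset.mem_range.mpr hn)
  rw [hleft] at h
  simpa [hx] using h

/-- The coefficients of a TVD scheme, scaled by `lam`, are nonnegative. -/
theorem coeff_nonneg_of_tvd (k : ℕ) (lam : ℝ) (Ap Am : ℕ → ℝ → ℝ → ℝ)
    (hAp : ∀ i, k ≤ i → ∀ a b : ℝ, Ap i a b = 0)
    (hAm : ∀ i, k ≤ i → ∀ a b : ℝ, Am i a b = 0)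
    (hTV : ∀ U : ℤ → ℝ, (∃ (s : Finset ℤ) (c : ℝ), ∀ j ∉ s, U j = c) →
      ∑' j : ℤ, |fdsH lam k Ap Am U (j + 1) - fdsH lam k Ap Am U j| ≤
        ∑' j : ℤ, |U (j + 1) - U j|) (uL uR : ℝ) (hne : uL ≠ uR) :
    0 ≤ 1 - lam * Ap 0 uL uR + lam * Am 0 uL uR ∧
      ∀ i < k, 0 ≤ lam * (Ap i uL uR - Ap (i + 1) uL uR) ∧
        0 ≤ lam * (Am (i + 1) uL uR - Am i uL uR) := by
  obtain ⟨U, hUR, hUl, hUr⟩ : ∃ U : ℤ → ℝ, (∀ m : ℤ, k + 1 < m → m ≤ 3 * k + 3 → U m = uR) ∧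
      (∀ m : ℤ, m ≤ k + 1 → U m = uL) ∧ (∀ m : ℤ, 3 * k + 3 < m → U m = uL) :=
    ⟨fun m => if k + 1 < m ∧ m ≤ 3 * k + 3 then uR else uL,
      fun m h1 h2 => if_pos ⟨h1, h2⟩, fun m h => if_neg (by omega), fun m h => if_neg (by omega)⟩
  have key := fdsH_pulse_mul_nonneg k lam Ap Am hAp hAm uL uR U hUR hUl hUr (hTV U)
  have hd : 0 < (uR - uL) * (uR - uL) := mul_self_pos.mpr (sub_ne_zero.mpr hne.symm)
  have hL : U (k + 1) = uL := hUl _ le_rfl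
  have hR : U (k + 1 + 1) = uR := hUR _ (by omega) (by omega)
  have hD : ∀ m : ℤ, m ≠ k + 1 → m < 3 * k + 3 → U (m + 1) - U m = 0 := by
    intro m h1 h2
    rw [sub_eq_zero]
    by_cases h : m ≤ k
    · rw [hUl _ (by omega), hUl _ (by omega)]
    · rw [hUR _ (by omega) (by omega), hUR _ (by omega) (by omega)]
  refine ⟨?_, fun i hi => ⟨?_, ?_⟩⟩
  · have h := key (k + 1) (by omega)
    rw [fdsH_succ_sub lam k Ap Am hAp hAm, Finset.sum_eq_zero] at h
    · push_cast at h
      rw [hL, hR, add_zero, mul_assoc] at h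
      exact nonneg_of_mul_nonneg_left h hd
    · intro i hi
      have := Finset.mem_range.mp hi
      rw [hD _ (by push_cast; omega) (by push_cast; omega),
        hD _ (by push_cast; omega) (by push_cast; omega)]
      simp
  · have h := key (k + 1 + (1 + i)) (by omega)
    rw [fdsH_succ_sub lam k Ap Am hAp hAm, hD _ (by push_cast; omega) (by push_cast; omega),
      Finset.sum_eq_single_of_mem i (Finset.mem_range.mpr hi)] at h
    · rw [hD (_ + (1 + (i : ℤ))) (by push_cast; omega) (by push_cast; omega)] at h
      have e : ((k + 1 + (1 + i) : ℕ) : ℤ) - (1 + i) = k + 1 := by push_cast; ring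
      rw [e, hL, hR, mul_zero, zero_add, mul_zero, add_zero, mul_assoc] at h
      exact nonneg_of_mul_nonneg_left h hd
    · intro l hl hli
      have := Finset.mem_range.mp hl
      rw [hD _ (by push_cast; omega) (by push_cast; omega),
        hD _ (by push_cast; omega) (by push_cast; omega)]
      simp
  · have h := key (k - i) (by omega)
    rw [fdsH_succ_sub lam k Ap Am hAp hAm, hD _ (by omega) (by omega),
      Finset.sum_eq_single_of_mem i (Finset.mem_range.mpr hi)] at h
    · rw [hD (_ - (1 + (i : ℤ))) (by omega) (by omega)] at h
      have e : ((k - i : ℕ) : ℤ) + (1 + i) = k + 1 := by omega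
      rw [e, hL, hR, mul_zero, zero_add, mul_zero, zero_add, mul_assoc] at h
      exact nonneg_of_mul_nonneg_left h hd
    · intro l hl hli
      have := Finset.mem_range.mp hl
      rw [hD _ (by omega) (by omega), hD _ (by omega) (by omega)]
      simp

/-- A local (2k+1)-point flux-difference splitting scheme is unconditionally
TVD (total variation diminishing on every sequence that is constant outside a finite set
of indices) if and only if for every pair `uL ≠ uR`:
`1/λ − 𝒜^{0+} + 𝒜^{0−} ≥ 0`, `𝒜^{i+} − 𝒜^{(i+1)+} ≥ 0` and `𝒜^{(i+1)−} − 𝒜^{i−} ≥ 0`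
for all `i ≥ 0`. -/
theorem stmt_4 (k : ℕ) (hk : 1 ≤ k) (lam : ℝ) (hlam : 0 < lam)
    (Ap Am : ℕ → ℝ → ℝ → ℝ)
    (hAp : ∀ i, k ≤ i → ∀ a b : ℝ, Ap i a b = 0)
    (hAm : ∀ i, k ≤ i → ∀ a b : ℝ, Am i a b = 0) :
    (∀ U : ℤ → ℝ, (∃ (s : Finset ℤ) (c : ℝ), ∀ j ∉ s, U j = c) →
      ∑' j : ℤ, |fdsH lam k Ap Am U (j + 1) - fdsH lam k Ap Am U j| ≤
        ∑' j : ℤ, |U (j + 1) - U j|) ↔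
    (∀ uL uR : ℝ, uL ≠ uR →
      1 / lam - Ap 0 uL uR + Am 0 uL uR ≥ 0 ∧
      ∀ i : ℕ, Ap i uL uR - Ap (i + 1) uL uR ≥ 0 ∧ Am (i + 1) uL uR - Am i uL uR ≥ 0) := by
  constructor
  · intro hTV uL uR hne
    obtain ⟨h0, h⟩ := coeff_nonneg_of_tvd k lam Ap Am hAp hAm hTV uL uR hne
    refine ⟨?_, fun i => ?_⟩
    · have e : 1 / lam - Ap 0 uL uR + Am 0 uL uR =
          (1 - lam * Ap 0 uL uR + lam * Am 0 uL uR) / lam := by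
        field_simp
      rw [e]
      exact div_nonneg h0 hlam.le
    · by_cases hi : i < k
      · exact ⟨nonneg_of_mul_nonneg_right (h i hi).1 hlam,
          nonneg_of_mul_nonneg_right (h i hi).2 hlam⟩
      · simp [hAp i (by omega), hAp (i + 1) (by omega), hAm i (by omega),
          hAm (i + 1) (by omega)]
  · intro hc U hU
    refine (fdsH_summable_and_tsum_le lam k Ap Am hAp hAm U hU).2.trans_eq
      (tsum_congr fun j => ?_)
    by_cases hj : U j = U (j + 1)
    · simp [hj]
    · obtain ⟨h0, h⟩ := hc _ _ hj
      have h0' : 0 ≤ 1 - lam * Ap 0 (U j) (U (j + 1)) + lam * Am 0 (U j) (U (j + 1)) := by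
        have e : 1 - lam * Ap 0 (U j) (U (j + 1)) + lam * Am 0 (U j) (U (j + 1)) =
            lam * (1 / lam - Ap 0 (U j) (U (j + 1)) + Am 0 (U j) (U (j + 1))) := by
          field_simp
        rw [e]
        exact mul_nonneg hlam.le h0
      have hP := fun i => mul_nonneg hlam.le (h i).1
      have hQ := fun i => mul_nonneg hlam.le (h i).2
      simp only [abs_mul _ (U (j + 1) - U j), abs_of_nonneg h0', abs_of_nonneg (hP _),
        abs_of_nonneg (hQ _), ← add_mul, ← Finset.sum_mul]
      simp only [← mul_add, ← Finset.mul_sum, Finset.sum_add_distrib]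
      rw [Finset.sum_range_sub', Finset.sum_range_sub (fun i => Am i (U j) (U (j + 1))),
        hAp k le_rfl, hAm k le_rfl]
      ring
end

section
/- A local (2k+1)-point viscosity-form scheme with differentiable flux f is unconditionally TVD if and only if for every pair (u_L, u_R) with u_L ≠ u_R, the numbers Q^0 = Q^0(u_L,u_R), Q^{i±} = Q^{i±}(u_L,u_R) together with C = C(u_L,u_R) satisfy the TVD conditions: (a) 1 − Q^0 + Q^{1−} + Q^{1+} ≥ 0; (b) Q^0 − 4Q^{1+} + 2Q^{2+} − C ≥ 0 and Q^0 − 4Q^{1−} + 2Q^{2−} + C ≥ 0; (c) Q^{i+} − 2Q^{(i+1)+} + Q^{(i+2)+} ≥ 0 and Q^{i−} − 2Q^{(i+1)−} + Q^{(i+2)−} ≥ 0 for all i ≥ 1. -/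
/-- Weight of a jump in the viscous part of the flux located `n` edges to the right of it. -/
noncomputable def viscCoeff (q0 : ℝ) (qp qm : ℕ → ℝ) (n : ℤ) : ℝ :=
  if n = 0 then q0 / 2 else if 0 < n then qm n.toNat else qp (-n).toNat

/-- Contribution of a unit jump to the updated jump located `n` edges to the right of it. -/
noncomputable def viscKernel (c q0 : ℝ) (qp qm : ℕ → ℝ) (n : ℤ) : ℝ :=
  (if n = 0 then 1 else 0) + (viscCoeff q0 qp qm (n + 1) - 2 * viscCoeff q0 qp qm n
    + viscCoeff q0 qp qm (n - 1))
    + c / 2 * ((if n = 1 then 1 else 0) - (if n = -1 then 1 else 0))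

section Kernel

variable {k : ℕ} {c q0 : ℝ} {qp qm : ℕ → ℝ}

theorem viscCoeff_eq_zero (hk : 1 ≤ k) (hp : ∀ i, k ≤ i → qp i = 0) (hm : ∀ i, k ≤ i → qm i = 0)
    {n : ℤ} (hn : (k : ℤ) ≤ |n|) : viscCoeff q0 qp qm n = 0 := by
  unfold viscCoeff
  rcases lt_trichotomy n 0 with h | h | h
  · rw [abs_of_neg h] at hn
    rw [if_neg h.ne, if_neg (by omega)]
    exact hp _ (by omega)
  · subst h
    simp at hn
    omega
  · rw [abs_of_pos h] at hn
    rw [if_neg h.ne', if_pos h]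
    exact hm _ (by omega)

theorem viscKernel_eq_zero (hk : 1 ≤ k) (hp : ∀ i, k ≤ i → qp i = 0)
    (hm : ∀ i, k ≤ i → qm i = 0) {n : ℤ} (hn : (k : ℤ) < |n|) : viscKernel c q0 qp qm n = 0 := by
  unfold viscKernel
  have h : (k : ℤ) < n ∨ n < -k := by
    rcases lt_abs.1 hn with h | h
    · exact .inl h
    · exact .inr (by omega)
  rw [viscCoeff_eq_zero hk hp hm (n := n + 1) (le_abs.2 (by omega)),
    viscCoeff_eq_zero hk hp hm (n := n) hn.le,
    viscCoeff_eq_zero hk hp hm (n := n - 1) (le_abs.2 (by omega)),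
    if_neg (by omega), if_neg (by omega), if_neg (by omega)]
  ring

theorem summable_viscCoeff (hk : 1 ≤ k) (hp : ∀ i, k ≤ i → qp i = 0)
    (hm : ∀ i, k ≤ i → qm i = 0) : Summable (viscCoeff q0 qp qm) := by
  refine summable_of_ne_finset_zero (s := Finset.Ioo (-(k : ℤ)) k) fun n hn => ?_
  refine viscCoeff_eq_zero hk hp hm (le_abs.2 ?_)
  rw [Finset.mem_Ioo] at hn
  omega

theorem hasSum_viscKernel (hk : 1 ≤ k) (hp : ∀ i, k ≤ i → qp i = 0)
    (hm : ∀ i, k ≤ i → qm i = 0) : HasSum (viscKernel c q0 qp qm) 1 := by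
  obtain ⟨s, hs⟩ := summable_viscCoeff (q0 := q0) hk hp hm
  have hr : HasSum (fun n : ℤ => viscCoeff q0 qp qm (n + 1)) s :=
    (Equiv.addRight (1 : ℤ)).hasSum_iff (f := viscCoeff q0 qp qm) |>.2 hs
  have hl : HasSum (fun n : ℤ => viscCoeff q0 qp qm (n - 1)) s :=
    (Equiv.subRight (1 : ℤ)).hasSum_iff (f := viscCoeff q0 qp qm) |>.2 hs
  have hpt (n : ℤ) : HasSum (fun m : ℤ => if m = n then (1 : ℝ) else 0) 1 := hasSum_ite_eq n 1
  have h := ((hpt 0).add ((hr.sub (hs.mul_left 2)).add hl)).add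
    (((hpt 1).sub (hpt (-1))).mul_left (c / 2))
  rw [show 1 + (s - 2 * s + s) + c / 2 * (1 - 1) = (1 : ℝ) by ring] at h
  exact h.congr_fun fun n => by rw [viscKernel]

theorem viscKernel_nonneg_iff :
    (∀ n, 0 ≤ viscKernel c q0 qp qm n) ↔
      1 - q0 + qm 1 + qp 1 ≥ 0 ∧ q0 - 4 * qp 1 + 2 * qp 2 - c ≥ 0 ∧
      q0 - 4 * qm 1 + 2 * qm 2 + c ≥ 0 ∧
      ∀ i : ℕ, 1 ≤ i → qp i - 2 * qp (i + 1) + qp (i + 2) ≥ 0 ∧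
        qm i - 2 * qm (i + 1) + qm (i + 2) ≥ 0 := by
  have h0 : viscKernel c q0 qp qm 0 = 1 - q0 + qm 1 + qp 1 := by
    simp [viscKernel, viscCoeff]; ring
  have hr : 2 * viscKernel c q0 qp qm 1 = q0 - 4 * qm 1 + 2 * qm 2 + c := by
    simp [viscKernel, viscCoeff]; ring
  have hl : 2 * viscKernel c q0 qp qm (-1) = q0 - 4 * qp 1 + 2 * qp 2 - c := by
    simp [viscKernel, viscCoeff]; ring
  have hm (i : ℕ) (hi : 1 ≤ i) :
      viscKernel c q0 qp qm (i + 1) = qm i - 2 * qm (i + 1) + qm (i + 2) := by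
    unfold viscKernel viscCoeff
    rw [if_neg (by omega), if_neg (by omega), if_pos (by omega), if_neg (by omega),
      if_pos (by omega), if_neg (by omega), if_pos (by omega), if_neg (by omega),
      if_neg (by omega), show ((i : ℤ) + 1 + 1).toNat = i + 2 by omega,
      show ((i : ℤ) + 1).toNat = i + 1 by omega, show ((i : ℤ) + 1 - 1).toNat = i by omega]
    ring
  have hp (i : ℕ) (hi : 1 ≤ i) :
      viscKernel c q0 qp qm (-(i + 1)) = qp i - 2 * qp (i + 1) + qp (i + 2) := by
    unfold viscKernel viscCoeff
    rw [if_neg (by omega), if_neg (by omega), if_neg (by omega), if_neg (by omega),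
      if_neg (by omega), if_neg (by omega), if_neg (by omega), if_neg (by omega),
      if_neg (by omega), show (-(-((i : ℤ) + 1) + 1)).toNat = i by omega,
      show (-(-((i : ℤ) + 1))).toNat = i + 1 by omega,
      show (-(-((i : ℤ) + 1) - 1)).toNat = i + 2 by omega]
    ring
  constructor
  · intro h
    refine ⟨?_, ?_, ?_, fun i hi => ⟨?_, ?_⟩⟩
    · linarith [h 0]
    · linarith [h (-1)]
    · linarith [h 1]
    · linarith [h (-(i + 1)), hp i hi]
    · linarith [h (i + 1), hm i hi]
  · rintro ⟨ha, hb, hb', hc⟩ n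
    rcases lt_trichotomy n 0 with h | rfl | h
    · obtain ⟨i, rfl⟩ : ∃ i : ℕ, n = -(i + 1) := ⟨(-n - 1).toNat, by omega⟩
      rcases Nat.eq_zero_or_pos i with rfl | hi
      · norm_num
        linarith
      · linarith [hp i hi, (hc i hi).1]
    · linarith
    · obtain ⟨i, rfl⟩ : ∃ i : ℕ, n = i + 1 := ⟨(n - 1).toNat, by omega⟩
      rcases Nat.eq_zero_or_pos i with rfl | hi
      · norm_num
        linarith
      · linarith [hm i hi, (hc i hi).2]

end Kernel

theorem sum_Ioo_neg_eq {k : ℕ} (hk : 1 ≤ k) (g : ℤ → ℝ) :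
    ∑ n ∈ Finset.Ioo (-(k : ℤ)) k, g n =
      g 0 + ∑ i ∈ Finset.Icc 1 (k - 1), (g i + g (-(i : ℤ))) := by
  induction k, hk using Nat.le_induction with
  | base =>
    rw [show Finset.Ioo (-((1 : ℕ) : ℤ)) ((1 : ℕ) : ℤ) = {0} by decide]
    simp
  | succ k hk ih =>
    have h : Finset.Ioo (-((k + 1 : ℕ) : ℤ)) ((k + 1 : ℕ) : ℤ) =
        insert (k : ℤ) (insert (-(k : ℤ)) (Finset.Ioo (-(k : ℤ)) k)) := by
      ext n
      simp only [Finset.mem_insert, Finset.mem_Ioo]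
      omega
    rw [h, Finset.sum_insert (by simp; omega), Finset.sum_insert (by simp), ih,
      show k + 1 - 1 = (k - 1) + 1 by omega, Finset.sum_Icc_succ_top (by omega),
      show k - 1 + 1 = k by omega]
    ring

section Scheme

variable {lam : ℝ} {k : ℕ} {f : ℝ → ℝ} {Q0 : ℝ → ℝ → ℝ} {Qp Qm : ℕ → ℝ → ℝ → ℝ}

theorem lam_mul_viscF (hk : 1 ≤ k) (hlam : 0 < lam)
    (hQp : ∀ i, k ≤ i → ∀ a b : ℝ, Qp i a b = 0) (hQm : ∀ i, k ≤ i → ∀ a b : ℝ, Qm i a b = 0)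
    {U : ℤ → ℝ} {S : Finset ℤ} (hS : ∀ m ∉ S, U (m + 1) = U m) (j : ℤ) :
    lam * viscF lam k f Q0 Qp Qm U j = lam * (f (U j) + f (U (j + 1))) / 2 -
      ∑ m ∈ S, viscCoeff (Q0 (U m) (U (m + 1))) (fun i => Qp i (U m) (U (m + 1)))
        (fun i => Qm i (U m) (U (m + 1))) (j - m) * (U (m + 1) - U m) := by
  set h : ℤ → ℝ := fun m => viscCoeff (Q0 (U m) (U (m + 1))) (fun i => Qp i (U m) (U (m + 1)))
        (fun i => Qm i (U m) (U (m + 1))) (j - m) * (U (m + 1) - U m) with hh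
  have e1 : ∑ m ∈ S, h m = ∑' m, h m :=
    (tsum_eq_sum fun m hm => by simp [hh, hS m hm]).symm
  have e2 : ∑' n, h (j - n) = ∑' m, h m := (Equiv.subLeft j).tsum_eq h
  have e3 : ∑' n, h (j - n) = ∑ n ∈ Finset.Ioo (-(k : ℤ)) k, h (j - n) := by
    refine tsum_eq_sum fun n hn => ?_
    rw [Finset.mem_Ioo] at hn
    simp only [hh]
    rw [viscCoeff_eq_zero hk (fun i hi => hQp i hi _ _) (fun i hi => hQm i hi _ _)
      (le_abs.2 (by omega)), zero_mul]
  rw [e1, ← e2, e3, sum_Ioo_neg_eq hk, viscF]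
  have e4 : ∀ i ∈ Finset.Icc 1 (k - 1), h (j - i) + h (j - -(i : ℤ)) =
      Qm i (U (j - (i : ℤ))) (U (j + 1 - (i : ℤ))) * (U (j + 1 - (i : ℤ)) - U (j - (i : ℤ))) +
      Qp i (U (j + (i : ℤ))) (U (j + 1 + (i : ℤ))) * (U (j + 1 + (i : ℤ)) - U (j + (i : ℤ))) := by
    intro i hi
    have hi := (Finset.mem_Icc.1 hi).1
    simp only [hh, viscCoeff]
    rw [if_neg (by omega), if_pos (by omega), if_neg (by omega), if_neg (by omega),
      show j - (j - (i : ℤ)) = i by ring, show -(j - (j - -(i : ℤ))) = i by ring,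
      show j - -(i : ℤ) = j + i by ring, show j - (i : ℤ) + 1 = j + 1 - i by ring,
      show j + (i : ℤ) + 1 = j + 1 + i by ring, Int.toNat_natCast]
  have e5 : h (j - 0) = Q0 (U j) (U (j + 1)) / 2 * (U (j + 1) - U j) := by simp [hh, viscCoeff]
  rw [Finset.sum_congr rfl e4, e5]
  field_simp
  ring

/-- The kernel attached to the edge joining the states `a` and `b`. -/
noncomputable def edgeKernel (lam : ℝ) (f : ℝ → ℝ) (Q0 : ℝ → ℝ → ℝ) (Qp Qm : ℕ → ℝ → ℝ → ℝ)
    (a b : ℝ) : ℤ → ℝ :=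
  viscKernel (lam * (f b - f a) / (b - a)) (Q0 a b) (fun i => Qp i a b) (fun i => Qm i a b)

theorem viscH_sub (hk : 1 ≤ k) (hlam : 0 < lam)
    (hQp : ∀ i, k ≤ i → ∀ a b : ℝ, Qp i a b = 0) (hQm : ∀ i, k ≤ i → ∀ a b : ℝ, Qm i a b = 0)
    {U : ℤ → ℝ} {S : Finset ℤ} (hS : ∀ m ∉ S, U (m + 1) = U m) (j : ℤ) :
    viscH lam k f Q0 Qp Qm U (j + 1) - viscH lam k f Q0 Qp Qm U j =
      ∑ m ∈ S, edgeKernel lam f Q0 Qp Qm (U m) (U (m + 1)) (j - m) * (U (m + 1) - U m) := by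
  have hF := lam_mul_viscF (f := f) (Q0 := Q0) hk hlam hQp hQm hS
  have pick (g : ℤ → ℝ) (hg : ∀ m ∉ S, g m = 0) (l : ℤ) :
      g l = ∑ m ∈ S, if m = l then g m else 0 := by
    rw [Finset.sum_ite_eq']
    split_ifs with hl
    · rfl
    · exact hg l hl
  have hflux (m : ℤ) : lam * (f (U (m + 1)) - f (U m)) / (U (m + 1) - U m) * (U (m + 1) - U m) =
      lam * (f (U (m + 1)) - f (U m)) := by
    by_cases hm : U (m + 1) = U m
    · simp [hm]
    · rw [div_mul_cancel₀ _ (sub_ne_zero.2 hm)]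
  have hg : ∀ m ∉ S, lam * (f (U (m + 1)) - f (U m)) = 0 := fun m hm => by simp [hS m hm]
  have p0 := pick (fun m => U (m + 1) - U m) (fun m hm => by simp [hS m hm]) j
  have p1 := pick (fun m => lam * (f (U (m + 1)) - f (U m))) hg (j + 1)
  have p2 := pick (fun m => lam * (f (U (m + 1)) - f (U m))) hg (j - 1)
  have hj := hF j
  have hj1 := hF (j + 1)
  have hj2 := hF (j - 1)
  simp only [sub_add_cancel] at p2 hj2
  have key : viscH lam k f Q0 Qp Qm U (j + 1) - viscH lam k f Q0 Qp Qm U j =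
      (U (j + 1) - U j) - (lam * viscF lam k f Q0 Qp Qm U (j + 1)
        - 2 * (lam * viscF lam k f Q0 Qp Qm U j) + lam * viscF lam k f Q0 Qp Qm U (j - 1)) := by
    unfold viscH
    rw [add_sub_cancel_right]
    ring
  have split : viscH lam k f Q0 Qp Qm U (j + 1) - viscH lam k f Q0 Qp Qm U j =
      (U (j + 1) - U j) - (lam * (f (U (j + 1 + 1)) - f (U (j + 1)))) / 2
        + (lam * (f (U j) - f (U (j - 1)))) / 2 + (
      ∑ m ∈ S, viscCoeff (Q0 (U m) (U (m + 1))) (fun i => Qp i (U m) (U (m + 1)))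
        (fun i => Qm i (U m) (U (m + 1))) (j + 1 - m) * (U (m + 1) - U m) - 2 *
      ∑ m ∈ S, viscCoeff (Q0 (U m) (U (m + 1))) (fun i => Qp i (U m) (U (m + 1)))
        (fun i => Qm i (U m) (U (m + 1))) (j - m) * (U (m + 1) - U m) +
      ∑ m ∈ S, viscCoeff (Q0 (U m) (U (m + 1))) (fun i => Qp i (U m) (U (m + 1)))
        (fun i => Qm i (U m) (U (m + 1))) (j - 1 - m) * (U (m + 1) - U m)) := by
    rw [key, hj, hj1, hj2]
    ring
  rw [split, p0, p1, p2, Finset.sum_div, Finset.sum_div, Finset.mul_sum, ← Finset.sum_sub_distrib,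
    ← Finset.sum_sub_distrib, ← Finset.sum_add_distrib, ← Finset.sum_add_distrib,
    ← Finset.sum_add_distrib]
  refine Finset.sum_congr rfl fun m _ => ?_
  have hm := hflux m
  rw [edgeKernel, viscKernel, show j - m + 1 = j + 1 - m by ring,
    show j - m - 1 = j - 1 - m by ring]
  generalize lam * (f (U (m + 1)) - f (U m)) / (U (m + 1) - U m) = c at hm ⊢
  simp only [← hm, show j - m = 0 ↔ m = j by omega, show j - m = 1 ↔ m = j - 1 by omega,
    show j - m = -1 ↔ m = j + 1 by omega]
  split_ifs <;> ring

theorem hasSum_edgeKernel (hk : 1 ≤ k)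
    (hQp : ∀ i, k ≤ i → ∀ a b : ℝ, Qp i a b = 0) (hQm : ∀ i, k ≤ i → ∀ a b : ℝ, Qm i a b = 0)
    (a b : ℝ) : HasSum (edgeKernel lam f Q0 Qp Qm a b) 1 :=
  hasSum_viscKernel hk (fun i hi => hQp i hi a b) (fun i hi => hQm i hi a b)

theorem edgeKernel_eq_zero (hk : 1 ≤ k)
    (hQp : ∀ i, k ≤ i → ∀ a b : ℝ, Qp i a b = 0) (hQm : ∀ i, k ≤ i → ∀ a b : ℝ, Qm i a b = 0)
    (a b : ℝ) {n : ℤ} (hn : (k : ℤ) < |n|) : edgeKernel lam f Q0 Qp Qm a b n = 0 :=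
  viscKernel_eq_zero hk (fun i hi => hQp i hi a b) (fun i hi => hQm i hi a b) hn

theorem tvd_of_edgeKernel_nonneg (hk : 1 ≤ k) (hlam : 0 < lam)
    (hQp : ∀ i, k ≤ i → ∀ a b : ℝ, Qp i a b = 0) (hQm : ∀ i, k ≤ i → ∀ a b : ℝ, Qm i a b = 0)
    (hA : ∀ a b, a ≠ b → ∀ n, 0 ≤ edgeKernel lam f Q0 Qp Qm a b n)
    {U : ℤ → ℝ} {S : Finset ℤ} (hS : ∀ m ∉ S, U (m + 1) = U m) :
    ∑' j : ℤ, |viscH lam k f Q0 Qp Qm U (j + 1) - viscH lam k f Q0 Qp Qm U j| ≤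
      ∑' j : ℤ, |U (j + 1) - U j| := by
  have hsum : HasSum (fun j : ℤ => ∑ m ∈ S,
      edgeKernel lam f Q0 Qp Qm (U m) (U (m + 1)) (j - m) * |U (m + 1) - U m|)
      (∑ m ∈ S, |U (m + 1) - U m|) := by
    refine hasSum_sum fun m _ => ?_
    have h : HasSum (fun j : ℤ => edgeKernel lam f Q0 Qp Qm (U m) (U (m + 1)) (j - m)) 1 :=
      (Equiv.subRight m).hasSum_iff.2 (hasSum_edgeKernel hk hQp hQm _ _)
    simpa using h.mul_right |U (m + 1) - U m|
  have hle (j : ℤ) : |viscH lam k f Q0 Qp Qm U (j + 1) - viscH lam k f Q0 Qp Qm U j| ≤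
      ∑ m ∈ S, edgeKernel lam f Q0 Qp Qm (U m) (U (m + 1)) (j - m) * |U (m + 1) - U m| := by
    rw [viscH_sub hk hlam hQp hQm hS]
    refine (Finset.abs_sum_le_sum_abs _ _).trans (Finset.sum_le_sum fun m _ => ?_)
    by_cases hm : U m = U (m + 1)
    · simp [hm]
    · rw [abs_mul, abs_of_nonneg (hA _ _ hm _)]
  rw [tsum_eq_sum (s := S) (f := fun j => |U (j + 1) - U j|) fun m hm => by simp [hS m hm],
    ← hsum.tsum_eq]
  exact (Summable.of_nonneg_of_le (fun _ => abs_nonneg _) hle hsum.summable).tsum_le_tsum hle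
    hsum.summable

theorem edgeKernel_nonneg_of_tvd (hk : 1 ≤ k) (hlam : 0 < lam)
    (hQp : ∀ i, k ≤ i → ∀ a b : ℝ, Qp i a b = 0) (hQm : ∀ i, k ≤ i → ∀ a b : ℝ, Qm i a b = 0)
    (hT : ∀ U : ℤ → ℝ, (∃ (s : Finset ℤ) (c : ℝ), ∀ j ∉ s, U j = c) →
      ∑' j : ℤ, |viscH lam k f Q0 Qp Qm U (j + 1) - viscH lam k f Q0 Qp Qm U j| ≤
        ∑' j : ℤ, |U (j + 1) - U j|) {a b : ℝ} (hab : a ≠ b) (n : ℤ) :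
    0 ≤ edgeKernel lam f Q0 Qp Qm a b n := by
  -- A plateau of height `b` over the background `a`, wide enough for the two jumps not to interact.
  set N : ℤ := 2 * k + 1 with hN
  set U : ℤ → ℝ := fun j => if 0 < j ∧ j ≤ N then b else a with hU
  have hS : ∀ m ∉ ({0, N} : Finset ℤ), U (m + 1) = U m := by
    intro m hm
    simp only [Finset.mem_insert, Finset.mem_singleton, not_or] at hm
    have : (0 < m + 1 ∧ m + 1 ≤ N) ↔ (0 < m ∧ m ≤ N) := by omega
    simp only [hU, this]
  have hN0 : (0 : ℤ) ≠ N := by omega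
  have u0 : U 0 = a := by simp [hU]
  have u1 : U (0 + 1) = b := if_pos (by omega)
  have uN : U N = b := if_pos (by omega)
  have uN1 : U (N + 1) = a := if_neg (by omega)
  have hd : 0 < |b - a| := abs_pos.2 (sub_ne_zero.2 hab.symm)
  set A := edgeKernel lam f Q0 Qp Qm a b with hA
  set B := edgeKernel lam f Q0 Qp Qm b a with hB
  have sA : HasSum A 1 := hasSum_edgeKernel hk hQp hQm a b
  have sB : HasSum (fun j => B (j - N)) 1 :=
    (Equiv.subRight N).hasSum_iff.2 (hasSum_edgeKernel hk hQp hQm b a)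
  have hjump (j : ℤ) : |viscH lam k f Q0 Qp Qm U (j + 1) - viscH lam k f Q0 Qp Qm U j| =
      (|A j| + |B (j - N)|) * |b - a| := by
    rw [viscH_sub hk hlam hQp hQm hS, Finset.sum_pair hN0, u0, u1, uN, uN1, sub_zero, ← hA, ← hB]
    by_cases hj : (k : ℤ) < |j|
    · rw [show A j = 0 from edgeKernel_eq_zero hk hQp hQm a b hj]
      simp [abs_mul, abs_sub_comm a b]
    · have : (k : ℤ) < |j - N| := by
        have := abs_le.1 (not_lt.1 hj)
        exact lt_abs.2 (by omega)
      rw [show B (j - N) = 0 from edgeKernel_eq_zero hk hQp hQm b a this]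
      simp [abs_mul]
  have hTU := hT U ⟨Finset.Icc 1 N, a, fun j hj => if_neg fun h => hj
    (Finset.mem_Icc.2 ⟨by omega, h.2⟩)⟩
  rw [tsum_congr hjump, tsum_mul_right, sA.summable.abs.tsum_add sB.summable.abs,
    tsum_eq_sum (s := {0, N}) (f := fun j => |U (j + 1) - U j|) fun m hm => by simp [hS m hm],
    Finset.sum_pair hN0, u0, u1, uN, uN1, abs_sub_comm a b, ← two_mul] at hTU
  have hle := le_of_mul_le_mul_right hTU hd
  have hB1 : 1 ≤ ∑' j, |B (j - N)| :=
    sB.tsum_eq ▸ sB.summable.tsum_le_tsum (fun j => le_abs_self _) sB.summable.abs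
  have hdef := sA.summable.abs.hasSum.sub sA
  have hn := le_hasSum hdef n fun j _ => sub_nonneg.2 (le_abs_self _)
  linarith [abs_nonneg (A n)]

end Scheme

/-- A local (2k+1)-point viscosity-form scheme is unconditionally TVD if and
only if for every pair `uL ≠ uR`, with `C = λ(f(uR) − f(uL))/(uR − uL)`:
(a) `1 − Q^0 + Q^{1−} + Q^{1+} ≥ 0`;
(b) `Q^0 − 4Q^{1+} + 2Q^{2+} − C ≥ 0` and `Q^0 − 4Q^{1−} + 2Q^{2−} + C ≥ 0`;
(c) `Q^{i±} − 2Q^{(i+1)±} + Q^{(i+2)±} ≥ 0` for all `i ≥ 1`. -/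
theorem stmt_5 (k : ℕ) (hk : 1 ≤ k) (lam : ℝ) (hlam : 0 < lam)
    (f : ℝ → ℝ) (hf : Differentiable ℝ f)
    (Q0 : ℝ → ℝ → ℝ) (Qp Qm : ℕ → ℝ → ℝ → ℝ)
    (hQp : ∀ i, k ≤ i → ∀ a b : ℝ, Qp i a b = 0)
    (hQm : ∀ i, k ≤ i → ∀ a b : ℝ, Qm i a b = 0) :
    (∀ U : ℤ → ℝ, (∃ (s : Finset ℤ) (c : ℝ), ∀ j ∉ s, U j = c) →
      ∑' j : ℤ, |viscH lam k f Q0 Qp Qm U (j + 1) - viscH lam k f Q0 Qp Qm U j| ≤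
        ∑' j : ℤ, |U (j + 1) - U j|) ↔
    (∀ uL uR : ℝ, uL ≠ uR →
      1 - Q0 uL uR + Qm 1 uL uR + Qp 1 uL uR ≥ 0 ∧
      Q0 uL uR - 4 * Qp 1 uL uR + 2 * Qp 2 uL uR - lam * (f uR - f uL) / (uR - uL) ≥ 0 ∧
      Q0 uL uR - 4 * Qm 1 uL uR + 2 * Qm 2 uL uR + lam * (f uR - f uL) / (uR - uL) ≥ 0 ∧
      ∀ i : ℕ, 1 ≤ i →
        Qp i uL uR - 2 * Qp (i + 1) uL uR + Qp (i + 2) uL uR ≥ 0 ∧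
        Qm i uL uR - 2 * Qm (i + 1) uL uR + Qm (i + 2) uL uR ≥ 0) := by
  constructor
  · intro hT uL uR hne
    exact viscKernel_nonneg_iff.1 (edgeKernel_nonneg_of_tvd hk hlam hQp hQm hT hne)
  · rintro hcond U ⟨s, c, hc⟩
    refine tvd_of_edgeKernel_nonneg hk hlam hQp hQm
      (fun a b hab => viscKernel_nonneg_iff.2 (hcond a b hab))
      (S := s ∪ s.image fun j => j - 1) fun m hm => ?_
    simp only [Finset.mem_union, Finset.mem_image, not_or, not_exists, not_and] at hm
    rw [hc m hm.1, hc (m + 1) fun h => hm.2 _ h (by ring)]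
end

section
/- Let k ≥ 1 be an integer and let real numbers C, Q^0, Q^{i+}, Q^{i−} (i ≥ 1, with Q^{i+} = Q^{i−} = 0 for i ≥ k) satisfy the TVD conditions. Then Q^0 ≤ k, Q^{i+} ≤ ((k−i)/(2k))(k − C) and Q^{i−} ≤ ((k−i)/(2k))(k + C) for 1 ≤ i ≤ k−1. Moreover, these 2k−1 inequalities are either all strict or all equalities. -/
/-- The slopes `(f n - f 0) / n` of the chords from `0` of a convex sequence are monotone. -/
lemma chord_slope_le {f : ℕ → ℝ} (hf : ∀ i, 0 ≤ f i - 2 * f (i + 1) + f (i + 2))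
    {i k : ℕ} (hi : 1 ≤ i) (hik : i ≤ k) :
    (k : ℝ) * (f i - f 0) ≤ i * (f k - f 0) := by
  have step : ∀ n : ℕ, f n - f 0 ≤ n * (f (n + 1) - f n) := by
    intro n
    induction n with
    | zero => simp
    | succ n ih =>
      have h : 0 ≤ ((n : ℝ) + 1) * (f n - 2 * f (n + 1) + f (n + 2)) :=
        mul_nonneg (by positivity) (hf n)
      push_cast
      linarith
  induction k, hik using Nat.le_induction with
  | base => exact le_rfl
  | succ n hn ih =>
    have hn0 : (0 : ℝ) < n := by exact_mod_cast hi.trans hn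
    have h := mul_le_mul_of_nonneg_left (step n) (Nat.cast_nonneg (α := ℝ) i)
    have h' := mul_le_mul_of_nonneg_left ih (by positivity : (0 : ℝ) ≤ n + 1)
    push_cast
    refine le_of_mul_le_mul_left ?_ hn0
    nlinarith

/-- A convex sequence lies above the line through its first two terms. -/
lemma initial_line_le {f : ℕ → ℝ} (hf : ∀ i, 0 ≤ f i - 2 * f (i + 1) + f (i + 2)) (i : ℕ) :
    f 0 + i * (f 1 - f 0) ≤ f i := by
  rcases Nat.eq_zero_or_pos i with rfl | hi
  · simp
  · have h := chord_slope_le hf le_rfl hi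
    push_cast at h
    linarith

/-- One-sided consequences of the TVD conditions: an upper bound for the coefficients, and the
rigidity of the coefficients once the first one attains its bound. -/
lemma tvd_one_sided {k : ℕ} {c : ℝ} {Q : ℕ → ℝ} (hk : 1 ≤ k) (hQ : Q k = 0)
    (hb : 0 ≤ c - 4 * Q 1 + 2 * Q 2)
    (hc : ∀ i, 1 ≤ i → 0 ≤ Q i - 2 * Q (i + 1) + Q (i + 2)) {i : ℕ} (hi : 1 ≤ i) (hik : i ≤ k) :
    Q i ≤ ((k : ℝ) - i) / (2 * k) * c ∧
      (((k : ℝ) - 1) / (2 * k) * c ≤ Q 1 → Q i = ((k : ℝ) - i) / (2 * k) * c) := by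
  have hk0 : (0 : ℝ) < k := by exact_mod_cast hk
  set f : ℕ → ℝ := fun j => if j = 0 then c / 2 else Q j with hfdef
  have f0 : f 0 = c / 2 := by simp [hfdef]
  have fs : ∀ j, 1 ≤ j → f j = Q j := fun j hj => by
    simp [hfdef, Nat.one_le_iff_ne_zero.mp hj]
  have hf : ∀ j, 0 ≤ f j - 2 * f (j + 1) + f (j + 2) := by
    intro j
    rcases Nat.eq_zero_or_pos j with rfl | hj
    · rw [f0, fs _ (by omega), fs _ (by omega)]
      norm_num
      linarith
    · rw [fs _ hj, fs _ (by omega), fs _ (by omega)]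
      exact hc j hj
  have upper : Q i ≤ ((k : ℝ) - i) / (2 * k) * c := by
    have h := chord_slope_le hf hi hik
    rw [f0, fs _ hi, fs _ hk, hQ] at h
    rw [div_mul_eq_mul_div, le_div_iff₀ (by positivity)]
    linarith
  refine ⟨upper, fun h1 => le_antisymm upper ?_⟩
  have h := initial_line_le hf i
  rw [f0, fs _ hi, fs _ le_rfl] at h
  rw [div_mul_eq_mul_div, div_le_iff₀ (by positivity)] at h1 ⊢
  have h2 := mul_le_mul_of_nonneg_left h1 (Nat.cast_nonneg (α := ℝ) i)
  have h3 := mul_le_mul_of_nonneg_left h hk0.le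
  linarith


/-- If the coefficients `C, Q^0, Q^{i±}` (with `Q^{i±} = 0` for `i ≥ k`)
satisfy the TVD conditions, then `Q^0 ≤ k`, `Q^{i+} ≤ ((k−i)/(2k))(k − C)` and
`Q^{i−} ≤ ((k−i)/(2k))(k + C)` for `1 ≤ i ≤ k−1`; moreover these `2k−1` inequalities
are either all strict or all equalities. -/
theorem stmt_6 (k : ℕ) (hk : 1 ≤ k) (C Q0 : ℝ) (Qp Qm : ℕ → ℝ)
    (hQpk : ∀ i, k ≤ i → Qp i = 0) (hQmk : ∀ i, k ≤ i → Qm i = 0)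
    (ha : 1 - Q0 + Qm 1 + Qp 1 ≥ 0)
    (hbp : Q0 - 4 * Qp 1 + 2 * Qp 2 - C ≥ 0)
    (hbm : Q0 - 4 * Qm 1 + 2 * Qm 2 + C ≥ 0)
    (hcp : ∀ i, 1 ≤ i → Qp i - 2 * Qp (i + 1) + Qp (i + 2) ≥ 0)
    (hcm : ∀ i, 1 ≤ i → Qm i - 2 * Qm (i + 1) + Qm (i + 2) ≥ 0) :
    (Q0 ≤ k ∧
     ∀ i : ℕ, 1 ≤ i → i ≤ k - 1 →
       Qp i ≤ ((k : ℝ) - i) / (2 * k) * ((k : ℝ) - C) ∧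
       Qm i ≤ ((k : ℝ) - i) / (2 * k) * ((k : ℝ) + C)) ∧
    ((Q0 = k ∧
      ∀ i : ℕ, 1 ≤ i → i ≤ k - 1 →
        Qp i = ((k : ℝ) - i) / (2 * k) * ((k : ℝ) - C) ∧
        Qm i = ((k : ℝ) - i) / (2 * k) * ((k : ℝ) + C)) ∨
     (Q0 < k ∧
      ∀ i : ℕ, 1 ≤ i → i ≤ k - 1 →
        Qp i < ((k : ℝ) - i) / (2 * k) * ((k : ℝ) - C) ∧
        Qm i < ((k : ℝ) - i) / (2 * k) * ((k : ℝ) + C))) := by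
  have hk0 : (0 : ℝ) < k := by exact_mod_cast hk
  have hp {i : ℕ} (hi : 1 ≤ i) (hik : i ≤ k) :=
    tvd_one_sided (c := Q0 - C) hk (hQpk k le_rfl) (by linarith) hcp hi hik
  have hm {i : ℕ} (hi : 1 ≤ i) (hik : i ≤ k) :=
    tvd_one_sided (c := Q0 + C) hk (hQmk k le_rfl) (by linarith) hcm hi hik
  have hp1 := (hp le_rfl hk).1
  have hm1 := (hm le_rfl hk).1
  push_cast at hp1 hm1
  have hsum : ((k : ℝ) - 1) / (2 * k) * (Q0 - C) + ((k : ℝ) - 1) / (2 * k) * (Q0 + C)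
      = Q0 - Q0 / k := by
    field_simp
    ring
  have hQ0 : Q0 ≤ k := by
    have h : Q0 / k ≤ 1 := by linarith
    rwa [div_le_one hk0] at h
  rcases hQ0.eq_or_lt with heq | hlt
  · have hdiv : Q0 / k = 1 := by rw [heq, div_self hk0.ne']
    have key : ∀ i : ℕ, 1 ≤ i → i ≤ k - 1 →
        Qp i = ((k : ℝ) - i) / (2 * k) * ((k : ℝ) - C) ∧
        Qm i = ((k : ℝ) - i) / (2 * k) * ((k : ℝ) + C) := by
      intro i hi hik
      have hP := (hp hi (by omega)).2 (by linarith)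
      have hM := (hm hi (by omega)).2 (by linarith)
      rw [heq] at hP hM
      exact ⟨hP, hM⟩
    exact ⟨⟨hQ0, fun i hi hik => ⟨(key i hi hik).1.le, (key i hi hik).2.le⟩⟩,
      Or.inl ⟨heq, key⟩⟩
  · have key : ∀ i : ℕ, 1 ≤ i → i ≤ k - 1 →
        Qp i < ((k : ℝ) - i) / (2 * k) * ((k : ℝ) - C) ∧
        Qm i < ((k : ℝ) - i) / (2 * k) * ((k : ℝ) + C) := by
      intro i hi hik
      have hik' : (i : ℝ) < k := by exact_mod_cast (by omega : i < k)
      have hpos : 0 < ((k : ℝ) - i) / (2 * k) := div_pos (by linarith) (by positivity)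
      exact ⟨(hp hi (by omega)).1.trans_lt (mul_lt_mul_of_pos_left (by linarith) hpos),
        (hm hi (by omega)).1.trans_lt (mul_lt_mul_of_pos_left (by linarith) hpos)⟩
    exact ⟨⟨hQ0, fun i hi hik => ⟨(key i hi hik).1.le, (key i hi hik).2.le⟩⟩,
      Or.inr ⟨hlt, key⟩⟩
end

section
/- Let k ≥ 1 be an integer and let real numbers C, Q^0, Q^{i+}, Q^{i−} (i ≥ 1, with Q^{i+} = Q^{i−} = 0 for i ≥ k) satisfy the TVD conditions. Then Q^0 ≥ |C|, Q^{i+} ≥ max(0, −C − i) and Q^{i−} ≥ max(0, C − i) for all i ≥ 1. -/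
/-- A sequence that is convex from index `1` on and eventually zero is antitone and nonnegative
from index `1` on. -/
theorem succ_le_and_nonneg_of_convex_of_eventually_zero {Q : ℕ → ℝ} {k : ℕ}
    (hk : ∀ i, k ≤ i → Q i = 0)
    (hc : ∀ i, 1 ≤ i → Q i - 2 * Q (i + 1) + Q (i + 2) ≥ 0) {i : ℕ} (hi : 1 ≤ i) :
    Q (i + 1) ≤ Q i ∧ 0 ≤ Q i := by
  have key : ∀ n i, 1 ≤ i → k ≤ i + n → Q (i + 1) ≤ Q i ∧ 0 ≤ Q i := by
    intro n
    induction n with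
    | zero =>
      intro i _ h
      simp [hk i h, hk (i + 1) (by omega)]
    | succ n ih =>
      intro i hi h
      obtain ⟨h₁, h₂⟩ := ih (i + 1) (by omega) (by omega)
      have h₃ := hc i hi
      have h₄ : Q (i + 1 + 1) = Q (i + 2) := rfl
      constructor <;> linarith
  exact key k i hi (by omega)

/-- A sequence that is convex from index `1` on lies above the line through its values at `1`
and `2`. -/
theorem line_le_of_convex {Q : ℕ → ℝ}
    (hc : ∀ i, 1 ≤ i → Q i - 2 * Q (i + 1) + Q (i + 2) ≥ 0) {i : ℕ} (hi : 1 ≤ i) :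
    Q 1 - (i - 1) * (Q 1 - Q 2) ≤ Q i := by
  suffices h : Q 1 - (i - 1) * (Q 1 - Q 2) ≤ Q i ∧ Q i - Q (i + 1) ≤ Q 1 - Q 2 from h.1
  induction i, hi using Nat.le_induction with
  | base => simp
  | succ i hi ih =>
    obtain ⟨h₁, h₂⟩ := ih
    have h₃ := hc i hi
    have h₄ : Q (i + 1 + 1) = Q (i + 2) := rfl
    push_cast
    constructor <;> linarith

/-- If the coefficients `C, Q^0, Q^{i±}` (with `Q^{i±} = 0` for `i ≥ k`)
satisfy the TVD conditions, then `Q^0 ≥ |C|`, `Q^{i+} ≥ max(0, −C − i)` and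
`Q^{i−} ≥ max(0, C − i)` for all `i ≥ 1`. -/
theorem stmt_8 (k : ℕ) (hk : 1 ≤ k) (C Q0 : ℝ) (Qp Qm : ℕ → ℝ)
    (hQpk : ∀ i, k ≤ i → Qp i = 0) (hQmk : ∀ i, k ≤ i → Qm i = 0)
    (ha : 1 - Q0 + Qm 1 + Qp 1 ≥ 0)
    (hbp : Q0 - 4 * Qp 1 + 2 * Qp 2 - C ≥ 0)
    (hbm : Q0 - 4 * Qm 1 + 2 * Qm 2 + C ≥ 0)
    (hcp : ∀ i, 1 ≤ i → Qp i - 2 * Qp (i + 1) + Qp (i + 2) ≥ 0)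
    (hcm : ∀ i, 1 ≤ i → Qm i - 2 * Qm (i + 1) + Qm (i + 2) ≥ 0) :
    Q0 ≥ |C| ∧
    ∀ i : ℕ, 1 ≤ i →
      Qp i ≥ max 0 (-C - i) ∧ Qm i ≥ max 0 (C - i) := by
  obtain ⟨hp₁, hp₂⟩ := succ_le_and_nonneg_of_convex_of_eventually_zero hQpk hcp le_rfl
  obtain ⟨hm₁, hm₂⟩ := succ_le_and_nonneg_of_convex_of_eventually_zero hQmk hcm le_rfl
  norm_num at hp₁ hm₁
  refine ⟨abs_le.2 ⟨by linarith, by linarith⟩, fun i hi => ?_⟩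
  have hi' : (0 : ℝ) ≤ i - 1 := sub_nonneg.2 (by exact_mod_cast hi)
  have slope_p : ((i : ℝ) - 1) * (Qp 1 - Qp 2) ≤ i - 1 :=
    mul_le_of_le_one_right hi' (by linarith)
  have slope_m : ((i : ℝ) - 1) * (Qm 1 - Qm 2) ≤ i - 1 :=
    mul_le_of_le_one_right hi' (by linarith)
  have line_p := line_le_of_convex hcp hi
  have line_m := line_le_of_convex hcm hi
  exact ⟨max_le (succ_le_and_nonneg_of_convex_of_eventually_zero hQpk hcp hi).2 (by linarith),
    max_le (succ_le_and_nonneg_of_convex_of_eventually_zero hQmk hcm hi).2 (by linarith)⟩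
end

section
/- Let f : ℝ → ℝ be Lipschitz continuous with Lipschitz constant L, let λ > 0, and let i ∈ ℕ satisfy i ≥ λL. Then the LTS-Godunov partial viscosity coefficients of order i vanish: Q^{i+}_God(u_L, u_R) = 0 and Q^{i−}_God(u_L, u_R) = 0 for every pair u_L ≠ u_R. Equivalently, for a ≤ b one has min_{u∈[a,b]}(λ f(u) + i u) = λ f(a) + i a and min_{u∈[a,b]}(λ f(u) − i u) = λ f(b) − i b. -/
/-- `M_{uL,uR}(w)`: the minimum of `w` over `[uL,uR]` if `uL < uR`, and the maximum of
`w` over `[uR,uL]` otherwise. -/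
noncomputable def Mgod (uL uR : ℝ) (w : ℝ → ℝ) : ℝ :=
  if uL < uR then sInf (w '' Set.Icc uL uR) else sSup (w '' Set.Icc uR uL)

/-- LTS-Godunov partial viscosity coefficient `Q^{i+}_God`. -/
noncomputable def QGodp (lam : ℝ) (f : ℝ → ℝ) (i : ℕ) (uL uR : ℝ) : ℝ :=
  (lam * f uL + i * uL - Mgod uL uR (fun u => lam * f u + i * u)) / (uR - uL)

/-- LTS-Godunov partial viscosity coefficient `Q^{i−}_God`. -/
noncomputable def QGodm (lam : ℝ) (f : ℝ → ℝ) (i : ℕ) (uL uR : ℝ) : ℝ :=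
  (lam * f uR - i * uR - Mgod uL uR (fun u => lam * f u - i * u)) / (uR - uL)

/-- If `f` is `L`-Lipschitz and `lam * L ≤ c`, then `u ↦ lam * f u + c * u` is nondecreasing. -/
theorem monotone_mul_add_mul_of_lipschitz {lam L c : ℝ} (hlam : 0 ≤ lam) {f : ℝ → ℝ}
    (hf : ∀ a b : ℝ, |f a - f b| ≤ L * |a - b|) (hc : lam * L ≤ c) :
    Monotone fun u => lam * f u + c * u := by
  intro x y hxy
  have h := (le_abs_self _).trans (hf x y)
  rw [abs_of_nonpos (sub_nonpos.2 hxy)] at h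
  have h₁ := mul_le_mul_of_nonneg_left h hlam
  have h₂ := mul_le_mul_of_nonneg_right hc (sub_nonneg.2 hxy)
  dsimp only
  linarith

/-- If `f` is `L`-Lipschitz and `lam * L ≤ c`, then `u ↦ lam * f u - c * u` is nonincreasing. -/
theorem antitone_mul_sub_mul_of_lipschitz {lam L c : ℝ} (hlam : 0 ≤ lam) {f : ℝ → ℝ}
    (hf : ∀ a b : ℝ, |f a - f b| ≤ L * |a - b|) (hc : lam * L ≤ c) :
    Antitone fun u => lam * f u - c * u := by
  have hneg : ∀ a b : ℝ, |-f a - -f b| ≤ L * |a - b| := fun a b => by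
    rw [← neg_sub', abs_neg]
    exact hf a b
  intro x y hxy
  have h := monotone_mul_add_mul_of_lipschitz hlam hneg hc hxy
  dsimp only at h ⊢
  linarith

theorem Monotone.Mgod_eq {w : ℝ → ℝ} (hw : Monotone w) (uL uR : ℝ) : Mgod uL uR w = w uL := by
  unfold Mgod
  split_ifs with h
  · exact (hw.monotoneOn _).sInf_image_Icc h.le
  · exact (hw.monotoneOn _).sSup_image_Icc (not_lt.1 h)

theorem Antitone.Mgod_eq {w : ℝ → ℝ} (hw : Antitone w) (uL uR : ℝ) : Mgod uL uR w = w uR := by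
  unfold Mgod
  split_ifs with h
  · exact (hw.antitoneOn _).sInf_image_Icc h.le
  · exact (hw.antitoneOn _).sSup_image_Icc (not_lt.1 h)

/-- If `f` is Lipschitz with constant `L` and `i ≥ λL`, then the
LTS-Godunov partial viscosity coefficients of order `i` vanish:
`Q^{i+}_God(uL,uR) = 0` and `Q^{i−}_God(uL,uR) = 0` for every `uL ≠ uR`; equivalently,
for `a ≤ b`, `min_{u∈[a,b]}(λf(u) + iu) = λf(a) + ia` and
`min_{u∈[a,b]}(λf(u) − iu) = λf(b) − ib`. -/
theorem stmt_9 (lam : ℝ) (hlam : 0 < lam) (f : ℝ → ℝ) (L : ℝ)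
    (hf : ∀ a b : ℝ, |f a - f b| ≤ L * |a - b|)
    (i : ℕ) (hi : lam * L ≤ i) :
    (∀ uL uR : ℝ, uL ≠ uR → QGodp lam f i uL uR = 0 ∧ QGodm lam f i uL uR = 0) ∧
    (∀ a b : ℝ, a ≤ b →
      sInf ((fun u => lam * f u + i * u) '' Set.Icc a b) = lam * f a + i * a ∧
      sInf ((fun u => lam * f u - i * u) '' Set.Icc a b) = lam * f b - i * b) := by
  have hp := monotone_mul_add_mul_of_lipschitz hlam.le hf hi
  have hm := antitone_mul_sub_mul_of_lipschitz hlam.le hf hi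
  refine ⟨fun uL uR _ => ⟨?_, ?_⟩, fun a b hab => ⟨?_, ?_⟩⟩
  · rw [QGodp, hp.Mgod_eq, sub_self, zero_div]
  · rw [QGodm, hm.Mgod_eq, sub_self, zero_div]
  · exact (hp.monotoneOn _).sInf_image_Icc hab
  · exact (hm.antitoneOn _).sInf_image_Icc hab
end

section
/- Let k ≥ 1, λ > 0, and let f : ℝ → ℝ be differentiable. Consider the local (2k+1)-point viscosity-form scheme whose coefficients at each pair (u_L, u_R) are the LTS-LxF coefficients Q^0 = k, Q^{i+} = (k−i)(k − C(u_L,u_R))/(2k), Q^{i−} = (k−i)(k + C(u_L,u_R))/(2k) for 1 ≤ i ≤ k−1. Then for every sequence U : ℤ → ℝ and every j ∈ ℤ, the update satisfies H(U)_j = ½(U_{j−k} + U_{j+k}) − (λ/(2k))(f(U_{j+k}) − f(U_{j−k})); that is, the scheme is exactly the (2k+1)-point LTS-Lax-Friedrichs scheme. -/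
/-- The signed local cell interface Courant number. -/
noncomputable def courant (lam : ℝ) (f : ℝ → ℝ) (a b : ℝ) : ℝ :=
  if a = b then lam * deriv f a else lam * (f b - f a) / (b - a)

theorem courant_mul_sub (lam : ℝ) (f : ℝ → ℝ) (a b : ℝ) :
    courant lam f a b * (b - a) = lam * (f b - f a) := by
  unfold courant
  split_ifs with h
  · simp [h]
  · have : b - a ≠ 0 := sub_ne_zero.mpr (Ne.symm h)
    field_simp

/-- Summation by parts of a second difference against a linear weight. -/
theorem sum_linear_mul_second_diff (c : ℝ) (g : ℤ → ℝ) (m : ℕ) :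
    ∑ i ∈ Finset.Icc 1 m, (c - i) * (g ((i : ℤ) - 1) - 2 * g i + g ((i : ℤ) + 1)) =
      (c - 1) * g 0 - c * g 1 + (c - m) * g ((m : ℤ) + 1) - (c - 1 - m) * g m := by
  induction m with
  | zero => simp
  | succ m ih =>
    rw [Finset.sum_Icc_succ_top (by omega), ih]
    push_cast
    rw [show (m : ℤ) + 1 - 1 = m by ring]
    ring

/-- The local (2k+1)-point viscosity-form scheme with LTS-LxF coefficients
`Q^0 = k`, `Q^{i+} = (k−i)(k − C)/(2k)`, `Q^{i−} = (k−i)(k + C)/(2k)` for `1 ≤ i ≤ k−1`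
(and zero for `i ≥ k`) is exactly the (2k+1)-point LTS-Lax-Friedrichs scheme
`H(U)_j = ½(U_{j−k} + U_{j+k}) − (λ/(2k))(f(U_{j+k}) − f(U_{j−k}))`. -/
theorem stmt_10 (k : ℕ) (hk : 1 ≤ k) (lam : ℝ) (hlam : 0 < lam)
    (f : ℝ → ℝ) (hf : Differentiable ℝ f)
    (Q0 : ℝ → ℝ → ℝ) (Qp Qm : ℕ → ℝ → ℝ → ℝ)
    (hQ0 : ∀ a b : ℝ, Q0 a b = k)
    (hQpv : ∀ i, 1 ≤ i → i ≤ k - 1 → ∀ a b : ℝ,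
      Qp i a b = ((k : ℝ) - i) * ((k : ℝ) - courant lam f a b) / (2 * k))
    (hQmv : ∀ i, 1 ≤ i → i ≤ k - 1 → ∀ a b : ℝ,
      Qm i a b = ((k : ℝ) - i) * ((k : ℝ) + courant lam f a b) / (2 * k))
    (hQpk : ∀ i, k ≤ i → ∀ a b : ℝ, Qp i a b = 0)
    (hQmk : ∀ i, k ≤ i → ∀ a b : ℝ, Qm i a b = 0) :
    ∀ (U : ℤ → ℝ) (j : ℤ),
      viscH lam k f Q0 Qp Qm U j =
        (U (j - (k : ℤ)) + U (j + (k : ℤ))) / 2 -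
          lam / (2 * k) * (f (U (j + (k : ℤ))) - f (U (j - (k : ℤ)))) := by
  intro U j
  have hk0 : (k : ℝ) ≠ 0 := by exact_mod_cast (by omega : k ≠ 0)
  have hl0 : lam ≠ 0 := hlam.ne'
  obtain ⟨S, hS⟩ : ∃ S : ℤ → ℝ, ∀ l, S l =
      ∑ i ∈ Finset.Icc 1 (k - 1), ((k : ℝ) - i) / (2 * k) *
        ((k * (U (l + 1 - i) - U (l - i)) + lam * (f (U (l + 1 - i)) - f (U (l - i)))) +
         (k * (U (l + 1 + i) - U (l + i)) - lam * (f (U (l + 1 + i)) - f (U (l + i))))) :=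
    ⟨_, fun _ => rfl⟩
  have flux_sum (l : ℤ) : ∑ i ∈ Finset.Icc 1 (k - 1),
      (Qm i (U (l - (i : ℤ))) (U (l + 1 - (i : ℤ))) * (U (l + 1 - (i : ℤ)) - U (l - (i : ℤ))) +
       Qp i (U (l + (i : ℤ))) (U (l + 1 + (i : ℤ))) * (U (l + 1 + (i : ℤ)) - U (l + (i : ℤ)))) =
      S l := by
    rw [hS]
    refine Finset.sum_congr rfl fun i hi => ?_
    obtain ⟨h1, h2⟩ := Finset.mem_Icc.mp hi
    rw [hQmv i h1 h2, hQpv i h1 h2, ← courant_mul_sub, ← courant_mul_sub]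
    ring
  have parts := sum_linear_mul_second_diff k
    (fun i => (k * U (j - i) + lam * f (U (j - i))) + (k * U (j + i) - lam * f (U (j + i)))) (k - 1)
  have flux_diff : 2 * (k : ℝ) * (S j - S (j - 1)) =
      2 * (k - 1) * k * U j
        - k * ((k * U (j - 1) + lam * f (U (j - 1))) + (k * U (j + 1) - lam * f (U (j + 1))))
        + ((k * U (j - k) + lam * f (U (j - k))) + (k * U (j + k) - lam * f (U (j + k)))) := by
    have hcast : ((k - 1 : ℕ) : ℤ) + 1 = k := by omega
    have hcast' : ((k - 1 : ℕ) : ℝ) = k - 1 := by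
      rw [Nat.cast_sub hk, Nat.cast_one]
    rw [hcast, hcast'] at parts
    simp only [sub_zero, add_zero] at parts
    refine (Eq.trans ?_ parts).trans ?_
    · rw [hS, hS, ← Finset.sum_sub_distrib, Finset.mul_sum]
      refine Finset.sum_congr rfl fun i _ => ?_
      rw [show j - ((i : ℤ) - 1) = j + 1 - i by ring, show j - ((i : ℤ) + 1) = j - 1 - i by ring,
        show j + ((i : ℤ) - 1) = j - 1 + i by ring, show j + ((i : ℤ) + 1) = j + 1 + i by ring,
        show j - 1 + 1 = j by ring]
      field_simp
      ring
    · ring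
  have hSj : S j = S (j - 1) + (2 * (k : ℝ) * (S j - S (j - 1))) / (2 * k) := by
    field_simp
    ring
  unfold viscH viscF
  rw [flux_sum, flux_sum, hQ0, hQ0, hSj, flux_diff, show j - 1 + 1 = j by ring]
  field_simp
  ring
end

section
/- Let k ≥ 1 be an integer and C a real number with |C| ≤ k. Then the LTS-LxF coefficients Q^0 = k, Q^{i+} = (k−i)(k − C)/(2k), Q^{i−} = (k−i)(k + C)/(2k) for 1 ≤ i ≤ k−1 (and Q^{i±} = 0 for i ≥ k) satisfy the TVD conditions. -/
/-- The truncated ramp `i ↦ a (k - i)⁺` is the common form of both families of coefficients. -/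
theorem eq_mul_natCast_sub {k : ℕ} {x : ℝ} {Q : ℕ → ℝ}
    (hv : ∀ i, 1 ≤ i → i ≤ k - 1 → Q i = ((k : ℝ) - i) * x / (2 * k))
    (h0 : ∀ i, k ≤ i → Q i = 0) (i : ℕ) (hi : 1 ≤ i) :
    Q i = x / (2 * k) * ((k - i : ℕ) : ℝ) := by
  rcases le_or_gt k i with h | h
  · simp [h0 i h, Nat.sub_eq_zero_of_le h]
  · rw [hv i hi (by omega), Nat.cast_sub h.le]
    ring

theorem second_difference_natCast_sub_nonneg (k i : ℕ) :
    0 ≤ ((k - i : ℕ) : ℝ) - 2 * ((k - (i + 1) : ℕ) : ℝ) + ((k - (i + 2) : ℕ) : ℝ) := by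
  have h : 2 * (k - (i + 1)) ≤ (k - i) + (k - (i + 2)) := by omega
  have h' : (2 * (k - (i + 1) : ℕ) : ℝ) ≤ ((k - i : ℕ) : ℝ) + ((k - (i + 2) : ℕ) : ℝ) := by
    exact_mod_cast h
  linarith

/-- For `|C| ≤ k`, the LTS-LxF coefficients `Q^0 = k`,
`Q^{i+} = (k−i)(k − C)/(2k)`, `Q^{i−} = (k−i)(k + C)/(2k)` for `1 ≤ i ≤ k−1`
(and zero for `i ≥ k`) satisfy the TVD conditions. -/
theorem stmt_11 (k : ℕ) (hk : 1 ≤ k) (C : ℝ) (hC : |C| ≤ k)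
    (Q0 : ℝ) (Qp Qm : ℕ → ℝ)
    (hQ0 : Q0 = k)
    (hQpv : ∀ i, 1 ≤ i → i ≤ k - 1 → Qp i = ((k : ℝ) - i) * ((k : ℝ) - C) / (2 * k))
    (hQmv : ∀ i, 1 ≤ i → i ≤ k - 1 → Qm i = ((k : ℝ) - i) * ((k : ℝ) + C) / (2 * k))
    (hQpk : ∀ i, k ≤ i → Qp i = 0)
    (hQmk : ∀ i, k ≤ i → Qm i = 0) :
    1 - Q0 + Qm 1 + Qp 1 ≥ 0 ∧
    Q0 - 4 * Qp 1 + 2 * Qp 2 - C ≥ 0 ∧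
    Q0 - 4 * Qm 1 + 2 * Qm 2 + C ≥ 0 ∧
    ∀ i : ℕ, 1 ≤ i →
      Qp i - 2 * Qp (i + 1) + Qp (i + 2) ≥ 0 ∧
      Qm i - 2 * Qm (i + 1) + Qm (i + 2) ≥ 0 := by
  subst hQ0
  have hk0 : (0 : ℝ) < k := by exact_mod_cast hk
  obtain ⟨hC1, hC2⟩ := abs_le.mp hC
  have hp := eq_mul_natCast_sub hQpv hQpk
  have hm := eq_mul_natCast_sub hQmv hQmk
  have ha : 0 ≤ ((k : ℝ) - C) / (2 * k) := div_nonneg (by linarith) (by positivity)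
  have hb : 0 ≤ ((k : ℝ) + C) / (2 * k) := div_nonneg (by linarith) (by positivity)
  have hak : (k : ℝ) - C = ((k : ℝ) - C) / (2 * k) * (2 * k) := by field_simp
  have hbk : (k : ℝ) + C = ((k : ℝ) + C) / (2 * k) * (2 * k) := by field_simp
  have hab : ((k : ℝ) - C) / (2 * k) + ((k : ℝ) + C) / (2 * k) = 1 := by
    field_simp
    ring
  have h1 : ((k - 1 : ℕ) : ℝ) = k - 1 := by simp [Nat.cast_sub hk]
  have h2 : (k : ℝ) - 2 ≤ ((k - 2 : ℕ) : ℝ) := by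
    have h : k ≤ (k - 2) + 2 := by omega
    have h' : (k : ℝ) ≤ ((k - 2 : ℕ) : ℝ) + 2 := by exact_mod_cast h
    linarith
  rw [hp 1 le_rfl, hp 2 one_le_two, hm 1 le_rfl, hm 2 one_le_two, h1]
  refine ⟨?_, ?_, ?_, fun i hi => ?_⟩
  · linear_combination (1 - (k : ℝ)) * hab
  · linarith [mul_le_mul_of_nonneg_left h2 ha]
  · linarith [mul_le_mul_of_nonneg_left h2 hb]
  · rw [hp i hi, hp (i + 1) (by omega), hp (i + 2) (by omega),
      hm i hi, hm (i + 1) (by omega), hm (i + 2) (by omega)]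
    have h := second_difference_natCast_sub_nonneg k i
    constructor
    · linarith [mul_nonneg ha h]
    · linarith [mul_nonneg hb h]
end

section
/- Let k ≥ 1 be an integer and let real numbers C, Q^0, Q^{i+}, Q^{i−} (i ≥ 1, with Q^{i+} = Q^{i−} = 0 for i ≥ k) satisfy the TVD conditions. Then the total numerical viscosity satisfies Q^0 + 2 Σ_{i=1}^{k−1}(Q^{i+} + Q^{i−}) ≤ k², with equality if and only if Q^0 = k, Q^{i+} = (k−i)(k−C)/(2k) and Q^{i−} = (k−i)(k+C)/(2k) for all 1 ≤ i ≤ k−1; that is, the LTS-Lax-Friedrichs scheme is the unique most diffusive local (2k+1)-point TVD scheme. -/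
/-- A discretely convex sequence vanishing at `n` lies below the chord from `(0, f 0)` to `(n, 0)`. -/
lemma mul_le_of_convex_seq (n : ℕ) (f : ℕ → ℝ)
    (hf : ∀ i, 0 ≤ f i - 2 * f (i + 1) + f (i + 2)) (hn : f n = 0) (i : ℕ) (hi : i ≤ n) :
    n * f i ≤ (n - i) * f 0 := by
  induction n generalizing f i with
  | zero => simp [Nat.le_zero.mp hi]
  | succ n ih =>
    have ih' := ih (fun j => f (j + 1)) (fun j => hf (j + 1)) hn
    rcases i with _ | i
    · simp
    · have hin : i ≤ n := by omega
      rcases Nat.eq_zero_or_pos n with rfl | hpos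
      · obtain rfl : i = 0 := by omega
        simp_all
      · have hnpos : (0 : ℝ) < n := by exact_mod_cast hpos
        have hin' : (i : ℝ) ≤ n := by exact_mod_cast hin
        have h2 := ih' 1 hpos
        have h0 := mul_nonneg hnpos.le (hf 0)
        have hi' := ih' i hin
        simp only [zero_add, Nat.reduceAdd, Nat.cast_one] at h2 h0 hi'
        have h1 : ((n : ℝ) + 1) * f 1 ≤ n * f 0 := by linarith
        push_cast
        refine le_of_mul_le_mul_left ?_ hnpos
        have hstep := mul_le_mul_of_nonneg_left h1 (sub_nonneg.mpr hin')
        have hscale := mul_le_mul_of_nonneg_left hi' (by positivity : (0 : ℝ) ≤ n + 1)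
        linarith

lemma sum_Icc_const_sub_natCast (n : ℕ) (c : ℝ) :
    ∑ i ∈ Finset.Icc 1 n, (c - i) = n * c - n * (n + 1) / 2 := by
  induction n with
  | zero => simp
  | succ n ih =>
    rw [Finset.sum_Icc_succ_top (by omega), ih]
    push_cast
    ring

/-- Prepending a value to a sequence that is convex from index `1` on. -/
lemma mul_le_of_convex_seq_prepend (k : ℕ) (a : ℝ) (q : ℕ → ℝ) (hk : 1 ≤ k) (hq : q k = 0)
    (h0 : 0 ≤ a - 2 * q 1 + q 2)
    (hc : ∀ i, 1 ≤ i → 0 ≤ q i - 2 * q (i + 1) + q (i + 2)) (i : ℕ) (hi : 1 ≤ i) (hik : i ≤ k) :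
    k * q i ≤ (k - i) * a := by
  have h := mul_le_of_convex_seq k (fun j => if j = 0 then a else q j) ?_ ?_ i hik
  · simpa [show i ≠ 0 by omega] using h
  · rintro (_ | j)
    · simpa using h0
    · simpa using hc (j + 1) (by omega)
  · simpa [show k ≠ 0 by omega] using hq


/-- Under the TVD conditions, the total numerical viscosity satisfies
`Q^0 + 2 Σ_{i=1}^{k−1}(Q^{i+} + Q^{i−}) ≤ k²`, with equality if and only if the
coefficients are exactly the LTS-Lax-Friedrichs coefficients `Q^0 = k`,
`Q^{i+} = (k−i)(k−C)/(2k)`, `Q^{i−} = (k−i)(k+C)/(2k)` for `1 ≤ i ≤ k−1`. -/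
theorem stmt_12 (k : ℕ) (hk : 1 ≤ k) (C Q0 : ℝ) (Qp Qm : ℕ → ℝ)
    (hQpk : ∀ i, k ≤ i → Qp i = 0) (hQmk : ∀ i, k ≤ i → Qm i = 0)
    (ha : 1 - Q0 + Qm 1 + Qp 1 ≥ 0)
    (hbp : Q0 - 4 * Qp 1 + 2 * Qp 2 - C ≥ 0)
    (hbm : Q0 - 4 * Qm 1 + 2 * Qm 2 + C ≥ 0)
    (hcp : ∀ i, 1 ≤ i → Qp i - 2 * Qp (i + 1) + Qp (i + 2) ≥ 0)
    (hcm : ∀ i, 1 ≤ i → Qm i - 2 * Qm (i + 1) + Qm (i + 2) ≥ 0) :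
    Q0 + 2 * ∑ i ∈ Finset.Icc 1 (k - 1), (Qp i + Qm i) ≤ (k : ℝ) ^ 2 ∧
    (Q0 + 2 * ∑ i ∈ Finset.Icc 1 (k - 1), (Qp i + Qm i) = (k : ℝ) ^ 2 ↔
      (Q0 = k ∧
       ∀ i : ℕ, 1 ≤ i → i ≤ k - 1 →
         Qp i = ((k : ℝ) - i) * ((k : ℝ) - C) / (2 * k) ∧
         Qm i = ((k : ℝ) - i) * ((k : ℝ) + C) / (2 * k))) := by
  have hkpos : (0 : ℝ) < k := by exact_mod_cast hk
  have hp := mul_le_of_convex_seq_prepend k ((Q0 - C) / 2) Qp hk (hQpk k le_rfl)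
    (by linarith) hcp
  have hm := mul_le_of_convex_seq_prepend k ((Q0 + C) / 2) Qm hk (hQmk k le_rfl)
    (by linarith) hcm
  have hQ0 : Q0 ≤ k := by
    have hp1 := hp 1 le_rfl hk
    have hm1 := hm 1 le_rfl hk
    have ha' := mul_nonneg hkpos.le ha
    push_cast at hp1 hm1
    linarith
  have hterm : ∀ i ∈ Finset.Icc 1 (k - 1), Qp i + Qm i ≤ (k : ℝ) - i := by
    intro i hi
    rw [Finset.mem_Icc] at hi
    have hik : i ≤ k := by omega
    have hik' : (i : ℝ) ≤ k := by exact_mod_cast hik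
    refine le_of_mul_le_mul_left ?_ hkpos
    have hmul := mul_le_mul_of_nonneg_left hQ0 (sub_nonneg.mpr hik')
    linarith [hp i hi.1 hik, hm i hi.1 hik]
  have hsum : ∑ i ∈ Finset.Icc 1 (k - 1), ((k : ℝ) - i) = ((k : ℝ) ^ 2 - k) / 2 := by
    rw [sum_Icc_const_sub_natCast, Nat.cast_sub hk]
    push_cast
    ring
  have hle := Finset.sum_le_sum hterm
  refine ⟨by linarith, fun heq => ?_, ?_⟩
  · have hQ0k : Q0 = k := by linarith
    refine ⟨hQ0k, fun i hi hik => ?_⟩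
    have hi_eq := (Finset.sum_eq_sum_iff_of_le hterm).mp (by linarith) i
      (Finset.mem_Icc.mpr ⟨hi, hik⟩)
    have hpi := hp i hi (by omega)
    have hmi := hm i hi (by omega)
    have hmul : (k : ℝ) * Qp i + k * Qm i = k * (k - i) := by rw [← mul_add, hi_eq]
    rw [hQ0k] at hpi hmi
    constructor <;> rw [eq_div_iff (by positivity)] <;> linarith
  · rintro ⟨hQ0k, h⟩
    have hval : ∀ i ∈ Finset.Icc 1 (k - 1), Qp i + Qm i = (k : ℝ) - i := by
      intro i hi
      rw [Finset.mem_Icc] at hi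
      rw [(h i hi.1 hi.2).1, (h i hi.1 hi.2).2]
      field_simp
      ring
    rw [Finset.sum_congr rfl hval, hsum, hQ0k]
    ring
end

section
/- Let λ > 0 and C ∈ ℝ, and define the LTS-Roe flux-difference splitting coefficients 𝒜^{i+} = (1/λ)·max(0, min(C − i, 1)) and 𝒜^{i−} = (1/λ)·min(0, max(C + i, −1)) for i ∈ ℕ. Then the viscosity coefficients obtained from the transformation Q^{i+} = −λ Σ_{p≥i} 𝒜^{p−}, Q^0 = λ Σ_{p≥0}(𝒜^{p+} − 𝒜^{p−}), Q^{i−} = λ Σ_{p≥i} 𝒜^{p+} are Q^0 = |C|, Q^{i+} = max(0, −C − i) and Q^{i−} = max(0, C − i) for all i ≥ 1. -/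
/-- Unit clippings of `x - p` over the naturals `p` add up to the positive part of `x`. -/
theorem hasSum_max_zero_min_sub_natCast_one (x : ℝ) :
    HasSum (fun p : ℕ => max 0 (min (x - p) 1)) (max 0 x) := by
  have partial_sum (n : ℕ) :
      ∑ p ∈ Finset.range n, max 0 (min (x - p) 1) = max 0 x - max 0 (x - n) := by
    induction n with
    | zero => simp
    | succ n ih =>
      rw [Finset.sum_range_succ, ih]
      push_cast
      grind
  rw [hasSum_iff_tendsto_nat_of_nonneg fun p => le_max_left _ _]
  refine tendsto_const_nhds.congr' ?_
  filter_upwards [Filter.eventually_ge_atTop ⌈x⌉₊] with n hn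
  rw [partial_sum, max_eq_left (sub_nonpos.2 (Nat.ceil_le.1 hn)), sub_zero]

/-- The LTS-Roe flux-difference splitting coefficients
`𝒜^{i+} = (1/λ) max(0, min(C − i, 1))`, `𝒜^{i−} = (1/λ) min(0, max(C + i, −1))`
transform, under `Q^{i+} = −λ Σ_{p≥i} 𝒜^{p−}`, `Q^0 = λ Σ_{p≥0}(𝒜^{p+} − 𝒜^{p−})`,
`Q^{i−} = λ Σ_{p≥i} 𝒜^{p+}`, into the viscosity coefficients `Q^0 = |C|`,
`Q^{i+} = max(0, −C − i)`, `Q^{i−} = max(0, C − i)` for all `i ≥ 1`. -/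
theorem stmt_13 (lam : ℝ) (hlam : 0 < lam) (C : ℝ)
    (Ap Am : ℕ → ℝ)
    (hAp : ∀ i : ℕ, Ap i = (1 / lam) * max 0 (min (C - i) 1))
    (hAm : ∀ i : ℕ, Am i = (1 / lam) * min 0 (max (C + i) (-1))) :
    lam * ∑' p : ℕ, (Ap p - Am p) = |C| ∧
    ∀ i : ℕ, 1 ≤ i →
      -lam * ∑' p : ℕ, Am (i + p) = max 0 (-C - i) ∧
      lam * ∑' p : ℕ, Ap (i + p) = max 0 (C - i) := by
  have hAm' (i : ℕ) : Am i = -(1 / lam) * max 0 (min (-C - i) 1) := by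
    rw [hAm, neg_mul, ← mul_neg]
    congr 1
    grind
  have sum_Ap (i : ℕ) : HasSum (fun p => Ap (i + p)) (1 / lam * max 0 (C - i)) := by
    simpa only [hAp, Nat.cast_add, sub_sub] using
      (hasSum_max_zero_min_sub_natCast_one (C - i)).mul_left (1 / lam)
  have sum_Am (i : ℕ) : HasSum (fun p => Am (i + p)) (-(1 / lam) * max 0 (-C - i)) := by
    simpa only [hAm', Nat.cast_add, sub_sub] using
      (hasSum_max_zero_min_sub_natCast_one (-C - i)).mul_left (-(1 / lam))
  refine ⟨?_, fun i _ => ⟨?_, ?_⟩⟩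
  · have h := (sum_Ap 0).sub (sum_Am 0)
    simp only [zero_add, Nat.cast_zero, sub_zero] at h
    rw [h.tsum_eq]
    field_simp
    grind
  · rw [(sum_Am i).tsum_eq]
    field_simp
  · rw [(sum_Ap i).tsum_eq]
    field_simp
end

section
/- Let k ≥ 1 be an integer and C a real number with |C| ≤ k. Then the LTS-Roe coefficients Q^0 = |C|, Q^{i+} = max(0, −C − i), Q^{i−} = max(0, C − i) (i ≥ 1), which vanish for i ≥ k, satisfy the TVD conditions. -/
/-- The second difference of the positive part is nonnegative. -/
theorem posPart_second_difference_nonneg (x y : ℝ) :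
    0 ≤ max 0 (x - y) - 2 * max 0 (x - (y + 1)) + max 0 (x - (y + 2)) := by
  rcases max_cases 0 (x - y) with h | h <;>
  rcases max_cases 0 (x - (y + 1)) with h' | h' <;>
  rcases max_cases 0 (x - (y + 2)) with h'' | h'' <;>
  linarith


/-- For `|C| ≤ k`, the LTS-Roe coefficients `Q^0 = |C|`,
`Q^{i+} = max(0, −C − i)`, `Q^{i−} = max(0, C − i)` (for `i ≥ 1`) vanish for `i ≥ k` and
satisfy the TVD conditions. -/
theorem stmt_14 (k : ℕ) (hk : 1 ≤ k) (C : ℝ) (hC : |C| ≤ k)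
    (Q0 : ℝ) (Qp Qm : ℕ → ℝ)
    (hQ0 : Q0 = |C|)
    (hQp : ∀ i : ℕ, 1 ≤ i → Qp i = max 0 (-C - i))
    (hQm : ∀ i : ℕ, 1 ≤ i → Qm i = max 0 (C - i)) :
    (∀ i, k ≤ i → Qp i = 0 ∧ Qm i = 0) ∧
    1 - Q0 + Qm 1 + Qp 1 ≥ 0 ∧
    Q0 - 4 * Qp 1 + 2 * Qp 2 - C ≥ 0 ∧
    Q0 - 4 * Qm 1 + 2 * Qm 2 + C ≥ 0 ∧
    ∀ i : ℕ, 1 ≤ i →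
      Qp i - 2 * Qp (i + 1) + Qp (i + 2) ≥ 0 ∧
      Qm i - 2 * Qm (i + 1) + Qm (i + 2) ≥ 0 := by
  obtain ⟨hC₁, hC₂⟩ := abs_le.mp hC
  have hp1 := hQp 1 le_rfl
  have hp2 := hQp 2 one_le_two
  have hm1 := hQm 1 le_rfl
  have hm2 := hQm 2 one_le_two
  have hp := posPart_second_difference_nonneg (-C) 0
  have hm := posPart_second_difference_nonneg C 0
  have hCp : 2 * max 0 (-C) = |C| - C := by
    rcases abs_cases C with h | h <;> rcases max_cases 0 (-C) with h' | h' <;> linarith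
  have hCm : 2 * max 0 C = |C| + C := by
    rcases abs_cases C with h | h <;> rcases max_cases 0 C with h' | h' <;> linarith
  simp only [sub_zero, zero_add] at hp hm
  push_cast at hp1 hp2 hm1 hm2
  refine ⟨fun i hi => ?_, ?_, ?_, ?_, fun i hi => ?_⟩
  · have hik : (k : ℝ) ≤ i := by exact_mod_cast hi
    rw [hQp i (hk.trans hi), hQm i (hk.trans hi)]
    exact ⟨max_eq_left (by linarith), max_eq_left (by linarith)⟩
  · rw [hQ0, hm1, hp1]
    rcases abs_cases C with h | h <;>
    linarith [le_max_left 0 (C - 1), le_max_right 0 (C - 1),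
      le_max_left 0 (-C - 1), le_max_right 0 (-C - 1)]
  · rw [hQ0, hp1, hp2]
    linarith
  · rw [hQ0, hm1, hm2]
    linarith
  · rw [hQp i hi, hQp (i + 1) (by omega), hQp (i + 2) (by omega),
      hQm i hi, hQm (i + 1) (by omega), hQm (i + 2) (by omega)]
    push_cast
    exact ⟨posPart_second_difference_nonneg (-C) i, posPart_second_difference_nonneg C i⟩
end

section
/- Let k ≥ 1 be an integer and let real numbers C, Q^0, Q^{i+}, Q^{i−} (i ≥ 1, with Q^{i+} = Q^{i−} = 0 for i ≥ k) satisfy the TVD conditions. Then the total numerical viscosity satisfies Q^0 + 2 Σ_{i=1}^{k−1}(Q^{i+} + Q^{i−}) ≥ |C| + 2 Σ_{i=1}^{k−1} max(0, |C| − i); that is, no local (2k+1)-point TVD scheme has smaller total numerical viscosity than the LTS-Roe scheme. -/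
/-- A discretely convex, eventually zero sequence is nonincreasing. -/
theorem succ_le_of_convex_of_eventually_zero {k : ℕ} {a : ℕ → ℝ} (h0 : ∀ i, k ≤ i → a i = 0)
    (hc : ∀ i, 1 ≤ i → a i - 2 * a (i + 1) + a (i + 2) ≥ 0) {i : ℕ} (hi : 1 ≤ i) :
    a (i + 1) ≤ a i := by
  obtain h | h := le_total k i
  · rw [h0 i h, h0 (i + 1) (by omega)]
  · induction h using Nat.decreasingInduction with
    | self => rw [h0 k le_rfl, h0 (k + 1) (by omega)]
    | of_succ i _ ih =>
      have h1 := ih (by omega)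
      have h2 := hc i hi
      rw [add_assoc] at h1
      norm_num at h1
      linarith

/-- A discretely convex, eventually zero sequence is nonnegative. -/
theorem nonneg_of_convex_of_eventually_zero {k : ℕ} {a : ℕ → ℝ} (h0 : ∀ i, k ≤ i → a i = 0)
    (hc : ∀ i, 1 ≤ i → a i - 2 * a (i + 1) + a (i + 2) ≥ 0) {i : ℕ} (hi : 1 ≤ i) :
    0 ≤ a i := by
  obtain h | h := le_total k i
  · rw [h0 i h]
  · induction h using Nat.decreasingInduction with
    | self => rw [h0 k le_rfl]
    | of_succ i _ ih =>
      exact (ih (by omega)).trans (succ_le_of_convex_of_eventually_zero h0 hc hi)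

/-- A discretely convex sequence that starts above `C - 1` with first decrement at most `1`
stays above `C - i`. -/
theorem sub_le_of_convex {a : ℕ → ℝ} {C : ℝ}
    (hc : ∀ i, 1 ≤ i → a i - 2 * a (i + 1) + a (i + 2) ≥ 0)
    (h1 : C - 1 ≤ a 1) (hd : a 1 - a 2 ≤ 1) {i : ℕ} (hi : 1 ≤ i) : C - i ≤ a i := by
  suffices h : C - i ≤ a i ∧ a i - a (i + 1) ≤ 1 from h.1
  induction i, hi using Nat.le_induction with
  | base => exact ⟨by simpa using h1, hd⟩
  | succ i hi ih =>
    have h2 := hc i hi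
    obtain ⟨h3, h4⟩ := ih
    push_cast
    exact ⟨by linarith, by rw [add_assoc]; norm_num; linarith⟩

/-- The viscosity bound for nonnegative Courant number `C`. -/
theorem viscosity_ge_of_nonneg {k : ℕ} {C Q0 : ℝ} (hC : 0 ≤ C) {Qp Qm : ℕ → ℝ}
    (hQpk : ∀ i, k ≤ i → Qp i = 0) (hQmk : ∀ i, k ≤ i → Qm i = 0)
    (ha : 1 - Q0 + Qm 1 + Qp 1 ≥ 0)
    (hbp : Q0 - 4 * Qp 1 + 2 * Qp 2 - C ≥ 0)
    (hbm : Q0 - 4 * Qm 1 + 2 * Qm 2 + C ≥ 0)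
    (hcp : ∀ i, 1 ≤ i → Qp i - 2 * Qp (i + 1) + Qp (i + 2) ≥ 0)
    (hcm : ∀ i, 1 ≤ i → Qm i - 2 * Qm (i + 1) + Qm (i + 2) ≥ 0) :
    Q0 + 2 * ∑ i ∈ Finset.Icc 1 (k - 1), (Qp i + Qm i) ≥
      |C| + 2 * ∑ i ∈ Finset.Icc 1 (k - 1), max 0 (|C| - i) := by
  rw [abs_of_nonneg hC]
  have hp : Qp 2 ≤ Qp 1 := succ_le_of_convex_of_eventually_zero hQpk hcp le_rfl
  have hp1 := nonneg_of_convex_of_eventually_zero hQpk hcp le_rfl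
  have hsum : ∑ i ∈ Finset.Icc 1 (k - 1), max 0 (C - i) ≤
      ∑ i ∈ Finset.Icc 1 (k - 1), (Qp i + Qm i) := by
    refine Finset.sum_le_sum fun i hi => ?_
    have hi := (Finset.mem_Icc.mp hi).1
    have hpi := nonneg_of_convex_of_eventually_zero hQpk hcp hi
    have hmi := nonneg_of_convex_of_eventually_zero hQmk hcm hi
    have hCi := sub_le_of_convex (C := C) hcm (by linarith) (by linarith) hi
    exact max_le (by linarith) (by linarith)
  linarith

/-- Under the TVD conditions, the total numerical viscosity satisfies
`Q^0 + 2 Σ_{i=1}^{k−1}(Q^{i+} + Q^{i−}) ≥ |C| + 2 Σ_{i=1}^{k−1} max(0, |C| − i)`;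
no local (2k+1)-point TVD scheme is less diffusive than LTS-Roe. -/
theorem stmt_15 (k : ℕ) (hk : 1 ≤ k) (C Q0 : ℝ) (Qp Qm : ℕ → ℝ)
    (hQpk : ∀ i, k ≤ i → Qp i = 0) (hQmk : ∀ i, k ≤ i → Qm i = 0)
    (ha : 1 - Q0 + Qm 1 + Qp 1 ≥ 0)
    (hbp : Q0 - 4 * Qp 1 + 2 * Qp 2 - C ≥ 0)
    (hbm : Q0 - 4 * Qm 1 + 2 * Qm 2 + C ≥ 0)
    (hcp : ∀ i, 1 ≤ i → Qp i - 2 * Qp (i + 1) + Qp (i + 2) ≥ 0)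
    (hcm : ∀ i, 1 ≤ i → Qm i - 2 * Qm (i + 1) + Qm (i + 2) ≥ 0) :
    Q0 + 2 * ∑ i ∈ Finset.Icc 1 (k - 1), (Qp i + Qm i) ≥
      |C| + 2 * ∑ i ∈ Finset.Icc 1 (k - 1), max 0 (|C| - i) := by
  obtain hC | hC := le_total 0 C
  · exact viscosity_ge_of_nonneg hC hQpk hQmk ha hbp hbm hcp hcm
  · have h := viscosity_ge_of_nonneg (C := -C) (Q0 := Q0) (by linarith) hQmk hQpk (by linarith)
      (by linarith) (by linarith) hcm hcp
    simpa only [abs_neg, add_comm (Qm _)] using h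
end

section
/- Let k ≥ 1 be an integer and let real numbers C, Q^0, Q^{i+}, Q^{i−} (i ≥ 1, with Q^{i+} = Q^{i−} = 0 for i ≥ k) satisfy the TVD conditions. Then: (i) |C| ≤ Q^0 ≤ k (so in particular |C| ≤ k is necessary); (ii) max(0, −C − i) ≤ Q^{i+} ≤ ((k−i)/(2k))(k − C) and max(0, C − i) ≤ Q^{i−} ≤ ((k−i)/(2k))(k + C) for 1 ≤ i ≤ k−1; and (iii) either all the upper bounds in (i)–(ii) are attained with equality (i.e. the coefficients are exactly the LTS-LxF coefficients), or all the upper-bound inequalities are strict. In other words, the partial numerical viscosity coefficients of every local (2k+1)-point unconditionally TVD scheme are bounded below by those of LTS-Roe and, unless the scheme is precisely LTS-LxF, strictly above by those of LTS-LxF. -/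
section DiscreteConvexity

variable {f : ℕ → ℝ}

lemma antitone_sub_succ (hf : ∀ i, 0 ≤ f i - 2 * f (i + 1) + f (i + 2)) :
    Antitone fun i => f i - f (i + 1) :=
  antitone_nat_of_succ_le fun i => by
    have := hf i
    simp only [add_assoc, Nat.reduceAdd]
    linarith

/-- A discretely convex sequence lies above its tangents, to the right of the contact point. -/
lemma tangent_le_right (hf : ∀ i, 0 ≤ f i - 2 * f (i + 1) + f (i + 2)) (i n : ℕ) :
    f i - n * (f i - f (i + 1)) ≤ f (i + n) := by
  induction n with
  | zero => simp
  | succ n ih =>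
    have h : f (i + n) - f (i + n + 1) ≤ f i - f (i + 1) :=
      antitone_sub_succ hf (Nat.le_add_right i n)
    rw [← add_assoc]
    push_cast
    linarith

/-- A discretely convex sequence lies above its tangents at the origin. -/
lemma tangent_le_zero (hf : ∀ i, 0 ≤ f i - 2 * f (i + 1) + f (i + 2)) (i : ℕ) :
    f i + i * (f i - f (i + 1)) ≤ f 0 := by
  induction i with
  | zero => simp
  | succ i ih =>
    have h := hf i
    have h' : (0 : ℝ) ≤ (i + 1) * (f i - 2 * f (i + 1) + f (i + 2)) := by positivity
    simp only [add_assoc, Nat.reduceAdd]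
    push_cast
    linarith

lemma succ_le_of_convex_of_eventually_zero_s16 {k : ℕ}
    (hf : ∀ i, 0 ≤ f i - 2 * f (i + 1) + f (i + 2)) (hk : ∀ i, k ≤ i → f i = 0) (i : ℕ) :
    f (i + 1) ≤ f i := by
  have h : f (i + k) - f (i + k + 1) ≤ f i - f (i + 1) :=
    antitone_sub_succ hf (Nat.le_add_right i k)
  rw [hk (i + k) (by lia), hk (i + k + 1) (by lia)] at h
  linarith

lemma nonneg_of_convex_of_eventually_zero_s16 {k : ℕ}
    (hf : ∀ i, 0 ≤ f i - 2 * f (i + 1) + f (i + 2)) (hk : ∀ i, k ≤ i → f i = 0) (i : ℕ) :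
    0 ≤ f i := by
  have h := antitone_nat_of_succ_le (succ_le_of_convex_of_eventually_zero_s16 hf hk)
    (Nat.le_add_right i k)
  rwa [hk (i + k) (by lia)] at h

/-- A discretely convex sequence vanishing at `k` lies below its chord over `[0, k]`. -/
lemma le_chord_of_convex {k i : ℕ} (hf : ∀ i, 0 ≤ f i - 2 * f (i + 1) + f (i + 2))
    (hk : f k = 0) (hi : i ≤ k) : k * f i ≤ (k - i) * f 0 := by
  obtain ⟨n, rfl⟩ := Nat.exists_eq_add_of_le hi
  have h₁ := tangent_le_right hf i n
  have h₂ := mul_le_mul_of_nonneg_left (tangent_le_zero hf i) n.cast_nonneg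
  rw [hk] at h₁
  have h₃ := mul_le_mul_of_nonneg_left h₁ i.cast_nonneg
  push_cast
  linarith

end DiscreteConvexity


/-- Under the TVD conditions,
(i) `|C| ≤ Q^0 ≤ k`;
(ii) `max(0, −C − i) ≤ Q^{i+} ≤ ((k−i)/(2k))(k − C)` and
`max(0, C − i) ≤ Q^{i−} ≤ ((k−i)/(2k))(k + C)` for `1 ≤ i ≤ k−1`;
(iii) either all the upper bounds are attained with equality (LTS-LxF), or all the
upper-bound inequalities are strict. -/
theorem stmt_16 (k : ℕ) (hk : 1 ≤ k) (C Q0 : ℝ) (Qp Qm : ℕ → ℝ)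
    (hQpk : ∀ i, k ≤ i → Qp i = 0) (hQmk : ∀ i, k ≤ i → Qm i = 0)
    (ha : 1 - Q0 + Qm 1 + Qp 1 ≥ 0)
    (hbp : Q0 - 4 * Qp 1 + 2 * Qp 2 - C ≥ 0)
    (hbm : Q0 - 4 * Qm 1 + 2 * Qm 2 + C ≥ 0)
    (hcp : ∀ i, 1 ≤ i → Qp i - 2 * Qp (i + 1) + Qp (i + 2) ≥ 0)
    (hcm : ∀ i, 1 ≤ i → Qm i - 2 * Qm (i + 1) + Qm (i + 2) ≥ 0) :
    (|C| ≤ Q0 ∧ Q0 ≤ k) ∧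
    (∀ i : ℕ, 1 ≤ i → i ≤ k - 1 →
      (max 0 (-C - i) ≤ Qp i ∧ Qp i ≤ ((k : ℝ) - i) / (2 * k) * ((k : ℝ) - C)) ∧
      (max 0 (C - i) ≤ Qm i ∧ Qm i ≤ ((k : ℝ) - i) / (2 * k) * ((k : ℝ) + C))) ∧
    ((Q0 = k ∧
      ∀ i : ℕ, 1 ≤ i → i ≤ k - 1 →
        Qp i = ((k : ℝ) - i) / (2 * k) * ((k : ℝ) - C) ∧
        Qm i = ((k : ℝ) - i) / (2 * k) * ((k : ℝ) + C)) ∨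
     (Q0 < k ∧
      ∀ i : ℕ, 1 ≤ i → i ≤ k - 1 →
        Qp i < ((k : ℝ) - i) / (2 * k) * ((k : ℝ) - C) ∧
        Qm i < ((k : ℝ) - i) / (2 * k) * ((k : ℝ) + C))) := by
  obtain ⟨A, hA0, hA⟩ : ∃ A : ℕ → ℝ, A 0 = (Q0 - C) / 2 ∧ ∀ i, 1 ≤ i → A i = Qp i :=
    ⟨fun i => if i = 0 then (Q0 - C) / 2 else Qp i, by simp, fun i hi => if_neg (by lia)⟩
  obtain ⟨B, hB0, hB⟩ : ∃ B : ℕ → ℝ, B 0 = (Q0 + C) / 2 ∧ ∀ i, 1 ≤ i → B i = Qm i :=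
    ⟨fun i => if i = 0 then (Q0 + C) / 2 else Qm i, by simp, fun i hi => if_neg (by lia)⟩
  have cA : ∀ i, 0 ≤ A i - 2 * A (i + 1) + A (i + 2) := by
    rintro (_ | i)
    · rw [zero_add, zero_add, hA0, hA 1 le_rfl, hA 2 (by lia)]
      linarith
    · rw [hA _ (by lia), hA _ (by lia), hA _ (by lia)]
      exact hcp _ (by lia)
  have cB : ∀ i, 0 ≤ B i - 2 * B (i + 1) + B (i + 2) := by
    rintro (_ | i)
    · rw [zero_add, zero_add, hB0, hB 1 le_rfl, hB 2 (by lia)]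
      linarith
    · rw [hB _ (by lia), hB _ (by lia), hB _ (by lia)]
      exact hcm _ (by lia)
  have zA : ∀ i, k ≤ i → A i = 0 := fun i hi => by rw [hA i (by lia), hQpk i hi]
  have zB : ∀ i, k ≤ i → B i = 0 := fun i hi => by rw [hB i (by lia), hQmk i hi]
  have nA := nonneg_of_convex_of_eventually_zero_s16 cA zA
  have nB := nonneg_of_convex_of_eventually_zero_s16 cB zB
  have sA := succ_le_of_convex_of_eventually_zero_s16 cA zA 0
  have sB := succ_le_of_convex_of_eventually_zero_s16 cB zB 0
  have tA := tangent_le_right cA 0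
  have tB := tangent_le_right cB 0
  simp only [zero_add] at sA sB tA tB
  have hsum : (A 0 - A 1) + (B 0 - B 1) ≤ 1 := by
    rw [hA0, hB0, hA 1 le_rfl, hB 1 le_rfl]
    linarith
  have hk0 : (0 : ℝ) < k := by exact_mod_cast hk
  have kA := tA k
  have kB := tB k
  rw [zA k le_rfl] at kA
  rw [zB k le_rfl] at kB
  have hksum := mul_le_mul_of_nonneg_left hsum hk0.le
  have hQ0k : Q0 ≤ k := by linarith
  have n0A := nA 0
  have n0B := nB 0
  have lower : ∀ i : ℕ, A 0 - i ≤ A i ∧ B 0 - i ≤ B i := fun i => by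
    have hi : (0 : ℝ) ≤ i := i.cast_nonneg
    have h₁ := mul_le_mul_of_nonneg_left (show A 0 - A 1 ≤ 1 by linarith) hi
    have h₂ := mul_le_mul_of_nonneg_left (show B 0 - B 1 ≤ 1 by linarith) hi
    have := tA i
    have := tB i
    constructor <;> linarith
  have upper : ∀ i : ℕ, i ≤ k →
      A i ≤ (k - i) / (2 * k) * (Q0 - C) ∧ B i ≤ (k - i) / (2 * k) * (Q0 + C) := fun i hi => by
    have h₁ := le_chord_of_convex cA (zA k le_rfl) hi
    have h₂ := le_chord_of_convex cB (zB k le_rfl) hi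
    rw [hA0] at h₁
    rw [hB0] at h₂
    constructor <;> rw [div_mul_eq_mul_div, le_div_iff₀ (by positivity)] <;> linarith
  have hcoef : ∀ i : ℕ, 1 ≤ i → i ≤ k - 1 → 0 < ((k : ℝ) - i) / (2 * k) := fun i h₁ h₂ => by
    have : (i : ℝ) < k := by exact_mod_cast (show i < k by lia)
    have := sub_pos.2 this
    positivity
  refine ⟨⟨abs_le.2 ⟨by linarith, by linarith⟩, hQ0k⟩, fun i h₁ h₂ => ?_, ?_⟩
  · rw [← hA i h₁, ← hB i h₁]
    obtain ⟨l₁, l₂⟩ := lower i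
    obtain ⟨u₁, u₂⟩ := upper i (by lia)
    have hc := (hcoef i h₁ h₂).le
    refine ⟨⟨max_le (nA i) (by linarith), u₁.trans ?_⟩, max_le (nB i) (by linarith), u₂.trans ?_⟩ <;>
      gcongr
  · rcases hQ0k.eq_or_lt with hQ | hQ
    · refine Or.inl ⟨hQ, fun i h₁ h₂ => ?_⟩
      rw [← hA i h₁, ← hB i h₁]
      obtain ⟨u₁, u₂⟩ := upper i (by lia)
      rw [hQ] at u₁ u₂
      have eA : A 0 - A 1 = (k - C) / (2 * k) := by
        rw [eq_div_iff (by positivity)]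
        linarith
      have eB : B 0 - B 1 = (k + C) / (2 * k) := by
        rw [eq_div_iff (by positivity)]
        linarith
      have v₁ := tA i
      have v₂ := tB i
      rw [eA, hA0, hQ] at v₁
      rw [eB, hB0, hQ] at v₂
      refine ⟨u₁.antisymm (le_of_eq_of_le ?_ v₁), u₂.antisymm (le_of_eq_of_le ?_ v₂)⟩ <;>
        field_simp
    · refine Or.inr ⟨hQ, fun i h₁ h₂ => ?_⟩
      rw [← hA i h₁, ← hB i h₁]
      obtain ⟨u₁, u₂⟩ := upper i (by lia)
      have hc := hcoef i h₁ h₂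
      refine ⟨u₁.trans_lt ?_, u₂.trans_lt ?_⟩ <;> gcongr
end

section
/- For every real number c, the total numerical viscosity of the LTS-Roe scheme satisfies the identity |c| − c² + 2 Σ_{i=1}^{∞} max(0, |c| − i) = (⌈|c|⌉ − |c|)(1 + |c| − ⌈|c|⌉), where ⌈·⌉ denotes the ceiling function and the sum is finite since the summands vanish for i ≥ |c|. In particular this quantity vanishes exactly when c is an integer. -/
theorem sum_range_sub_succ (x : ℝ) (m : ℕ) :
    ∑ i ∈ Finset.range m, (x - (i + 1 : ℕ)) = m * x - m * (m + 1) / 2 := by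
  induction m with
  | zero => simp
  | succ k ih =>
    rw [Finset.sum_range_succ, ih]
    push_cast
    ring

theorem tsum_max_zero_sub_succ {x : ℝ} {m : ℕ} (hm : (m : ℝ) ≤ x) (hx : x ≤ m + 1) :
    ∑' i : ℕ, max 0 (x - (i + 1 : ℕ)) = m * x - m * (m + 1) / 2 := by
  rw [tsum_eq_sum (s := Finset.range m), ← sum_range_sub_succ]
  · refine Finset.sum_congr rfl fun i hi => max_eq_right ?_
    have h : ((i + 1 : ℕ) : ℝ) ≤ m := by
      exact_mod_cast Finset.mem_range.mp hi
    linarith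
  · intro i hi
    have h : (m : ℝ) ≤ i := by
      exact_mod_cast not_lt.mp (mt Finset.mem_range.mpr hi)
    refine max_eq_left ?_
    push_cast
    linarith

theorem sub_sq_add_two_mul_tsum {x : ℝ} {m : ℕ} (hm : (m : ℝ) ≤ x) (hx : x ≤ m + 1) :
    x - x ^ 2 + 2 * ∑' i : ℕ, max 0 (x - (i + 1 : ℕ)) = (m + 1 - x) * (x - m) := by
  rw [tsum_max_zero_sub_succ hm hx]
  ring


/-- For every real `c`, the total numerical viscosity of the LTS-Roe scheme
satisfies `|c| − c² + 2 Σ_{i=1}^{∞} max(0, |c| − i) = (⌈|c|⌉ − |c|)(1 + |c| − ⌈|c|⌉)`;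
in particular this quantity vanishes exactly when `c` is an integer. -/
theorem stmt_17 (c : ℝ) :
    |c| - c ^ 2 + 2 * ∑' i : ℕ, max 0 (|c| - (i + 1 : ℕ)) =
      ((⌈|c|⌉ : ℝ) - |c|) * (1 + |c| - (⌈|c|⌉ : ℝ)) ∧
    (|c| - c ^ 2 + 2 * ∑' i : ℕ, max 0 (|c| - (i + 1 : ℕ)) = 0 ↔ ∃ n : ℤ, c = n) := by
  have hm : (⌊|c|⌋₊ : ℝ) ≤ |c| := Nat.floor_le (abs_nonneg c)
  have hlt : |c| < ⌊|c|⌋₊ + 1 := Nat.lt_floor_add_one |c|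
  rw [← sq_abs c, sub_sq_add_two_mul_tsum hm hlt.le]
  generalize ⌊|c|⌋₊ = m at hm hlt
  refine ⟨?_, ?_⟩
  · rcases hm.eq_or_lt with h | h
    · simp [← h]
    · have hceil : ⌈|c|⌉ = (m : ℤ) + 1 := by
        rw [Int.ceil_eq_iff]
        push_cast
        exact ⟨by linarith, hlt.le⟩
      rw [hceil]
      push_cast
      ring
  · rw [mul_eq_zero, or_iff_right (sub_pos.mpr hlt).ne', sub_eq_zero]
    constructor
    · intro h
      rcases (abs_eq (Nat.cast_nonneg m)).mp h with h | h
      · exact ⟨m, by simpa using h⟩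
      · exact ⟨-m, by simpa using h⟩
    · rintro ⟨n, rfl⟩
      have h₁ : (m : ℤ) ≤ |n| := by exact_mod_cast hm
      have h₂ : |n| < (m : ℤ) + 1 := by exact_mod_cast hlt
      have h : |n| = (m : ℤ) := by omega
      exact_mod_cast h
end

section
/- Let f : ℝ → ℝ be continuous, λ > 0, u_L ≠ u_R, and let C = λ(f(u_R) − f(u_L))/(u_R − u_L). Let M̂_{u_L,u_R}(w) denote min_{u∈{u_L,u_R}} w(u) if u_L < u_R and max_{u∈{u_L,u_R}} w(u) if u_L > u_R. Then: (i) λ(f(u_L) + f(u_R) − 2 M̂_{u_L,u_R}(f))/(u_R − u_L) = |C|, [λ f(u_L) + i·u_L − M̂_{u_L,u_R}(λ f(u) + i·u)]/(u_R − u_L) = max(0, −C − i), and [λ f(u_R) − i·u_R − M̂_{u_L,u_R}(λ f(u) − i·u)]/(u_R − u_L) = max(0, C − i) for every i ∈ ℕ (i.e. replacing the interval extremum by the two-point extremum in the LTS-Godunov coefficients yields exactly the LTS-Roe coefficients); and (ii) consequently Q^0_God(u_L,u_R) ≥ |C|, Q^{i+}_God(u_L,u_R) ≥ max(0, −C − i)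 and Q^{i−}_God(u_L,u_R) ≥ max(0, C − i), i.e. every LTS-Godunov partial viscosity coefficient dominates the corresponding LTS-Roe coefficient. -/
/-- `M̂_{uL,uR}(w)`: the two-point minimum `min(w uL, w uR)` if `uL < uR`, and the
two-point maximum otherwise. -/
noncomputable def Mhat (uL uR : ℝ) (w : ℝ → ℝ) : ℝ :=
  if uL < uR then min (w uL) (w uR) else max (w uL) (w uR)

/-- LTS-Godunov viscosity coefficient `Q^0_God`. -/
noncomputable def QGod0 (lam : ℝ) (f : ℝ → ℝ) (uL uR : ℝ) : ℝ :=
  lam * (f uL + f uR - 2 * Mgod uL uR f) / (uR - uL)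

theorem sub_Mhat_left_div {uL uR : ℝ} (h : uL ≠ uR) (w : ℝ → ℝ) :
    (w uL - Mhat uL uR w) / (uR - uL) = max 0 (-((w uR - w uL) / (uR - uL))) := by
  rw [← neg_div, neg_sub]
  unfold Mhat
  rcases h.lt_or_gt with hlt | hgt
  · have hd : 0 ≤ uR - uL := (sub_pos.2 hlt).le
    rw [if_pos hlt, ← max_sub_sub_left, sub_self, ← max_div_div_right hd, zero_div]
  · have hd : uR - uL ≤ 0 := (sub_neg.2 hgt).le
    rw [if_neg hgt.not_gt, ← min_sub_sub_left, sub_self, ← max_div_div_right_of_nonpos hd,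
      zero_div]

theorem sub_Mhat_right_div {uL uR : ℝ} (h : uL ≠ uR) (w : ℝ → ℝ) :
    (w uR - Mhat uL uR w) / (uR - uL) = max 0 ((w uR - w uL) / (uR - uL)) := by
  have hsplit : (w uR - Mhat uL uR w) / (uR - uL) =
      (w uL - Mhat uL uR w) / (uR - uL) + (w uR - w uL) / (uR - uL) := by ring
  rw [hsplit, sub_Mhat_left_div h, ← max_add_add_right, zero_add, neg_add_cancel, max_comm]

/-- The extremum over the whole interval is at least as extreme as the two-point extremum. -/
theorem Mgod_div_le_Mhat_div {uL uR : ℝ} (h : uL ≠ uR) {w : ℝ → ℝ} (hw : Continuous w) :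
    Mgod uL uR w / (uR - uL) ≤ Mhat uL uR w / (uR - uL) := by
  unfold Mgod Mhat
  rcases h.lt_or_gt with hlt | hgt
  · have hb : BddBelow (w '' Set.Icc uL uR) := (isCompact_Icc.image hw).bddBelow
    rw [if_pos hlt, if_pos hlt]
    refine div_le_div_of_nonneg_right (le_min ?_ ?_) (sub_pos.2 hlt).le
    · exact csInf_le hb (Set.mem_image_of_mem w (Set.left_mem_Icc.2 hlt.le))
    · exact csInf_le hb (Set.mem_image_of_mem w (Set.right_mem_Icc.2 hlt.le))
  · have hb : BddAbove (w '' Set.Icc uR uL) := (isCompact_Icc.image hw).bddAbove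
    rw [if_neg hgt.not_gt, if_neg hgt.not_gt]
    refine div_le_div_of_nonpos_of_le (sub_neg.2 hgt).le (max_le ?_ ?_)
    · exact le_csSup hb (Set.mem_image_of_mem w (Set.right_mem_Icc.2 hgt.le))
    · exact le_csSup hb (Set.mem_image_of_mem w (Set.left_mem_Icc.2 hgt.le))

theorem sub_Mhat_div_le_sub_Mgod_div {uL uR : ℝ} (h : uL ≠ uR) {w : ℝ → ℝ}
    (hw : Continuous w) (a : ℝ) :
    (a - Mhat uL uR w) / (uR - uL) ≤ (a - Mgod uL uR w) / (uR - uL) := by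
  rw [sub_div, sub_div]
  exact sub_le_sub_left (Mgod_div_le_Mhat_div h hw) _

/-- (i) replacing the interval extremum by the two-point extremum `M̂` in
the LTS-Godunov coefficients yields exactly the LTS-Roe coefficients `|C|`,
`max(0, −C − i)`, `max(0, C − i)`; and consequently (ii) every LTS-Godunov partial
viscosity coefficient dominates the corresponding LTS-Roe coefficient. -/
theorem stmt_18 (lam : ℝ) (hlam : 0 < lam) (f : ℝ → ℝ) (hf : Continuous f)
    (uL uR : ℝ) (h : uL ≠ uR)
    (C : ℝ) (hC : C = lam * (f uR - f uL) / (uR - uL)) :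
    (lam * (f uL + f uR - 2 * Mhat uL uR f) / (uR - uL) = |C| ∧
     ∀ i : ℕ,
       (lam * f uL + i * uL - Mhat uL uR (fun u => lam * f u + i * u)) / (uR - uL) =
         max 0 (-C - i) ∧
       (lam * f uR - i * uR - Mhat uL uR (fun u => lam * f u - i * u)) / (uR - uL) =
         max 0 (C - i)) ∧
    (QGod0 lam f uL uR ≥ |C| ∧
     ∀ i : ℕ,
       QGodp lam f i uL uR ≥ max 0 (-C - i) ∧
       QGodm lam f i uL uR ≥ max 0 (C - i)) := by
  have hne : uR - uL ≠ 0 := sub_ne_zero.2 h.symm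
  have roe_zero : lam * (f uL + f uR - 2 * Mhat uL uR f) / (uR - uL) = |C| := by
    have hsplit : lam * (f uL + f uR - 2 * Mhat uL uR f) / (uR - uL) =
        lam * ((f uL - Mhat uL uR f) / (uR - uL) + (f uR - Mhat uL uR f) / (uR - uL)) := by
      ring
    rw [hsplit, sub_Mhat_left_div h, sub_Mhat_right_div h, hC, mul_div_assoc, abs_mul,
      abs_of_pos hlam]
    congr 1
    rw [max_comm 0, max_comm 0, add_comm]
    exact posPart_add_negPart _
  have roe_plus (i : ℕ) :
      (lam * f uL + i * uL - Mhat uL uR (fun u => lam * f u + i * u)) / (uR - uL) =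
        max 0 (-C - i) := by
    refine (sub_Mhat_left_div h (fun u => lam * f u + i * u)).trans ?_
    congr 1
    rw [hC]
    field_simp
    ring
  have roe_minus (i : ℕ) :
      (lam * f uR - i * uR - Mhat uL uR (fun u => lam * f u - i * u)) / (uR - uL) =
        max 0 (C - i) := by
    refine (sub_Mhat_right_div h (fun u => lam * f u - i * u)).trans ?_
    congr 1
    rw [hC]
    field_simp
    ring
  refine ⟨⟨roe_zero, fun i => ⟨roe_plus i, roe_minus i⟩⟩, ?_, fun i => ⟨?_, ?_⟩⟩
  · rw [← roe_zero, QGod0, ge_iff_le, mul_div_assoc, mul_div_assoc, sub_div, sub_div,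
      mul_div_assoc, mul_div_assoc]
    have hM := Mgod_div_le_Mhat_div h hf
    gcongr
  · rw [← roe_plus i]
    exact sub_Mhat_div_le_sub_Mgod_div h (by fun_prop) _
  · rw [← roe_minus i]
    exact sub_Mhat_div_le_sub_Mgod_div h (by fun_prop) _
end

section
/- Let f : ℝ → ℝ be continuous, λ > 0, u_L ≠ u_R, and let C = λ(f(u_R) − f(u_L))/(u_R − u_L). Assume f is differentiable on the open interval J = (min(u_L,u_R), max(u_L,u_R)). Then for each i ∈ ℕ with i ≥ 1: if there is no u ∈ J with λ f'(u) = −i, then Q^{i+}_God(u_L,u_R) = max(0, −C − i); if there is no u ∈ J with λ f'(u) = i, then Q^{i−}_God(u_L,u_R) = max(0, C − i); and if there is no u ∈ J with f'(u) = 0, then Q^0_God(u_L,u_R) = |C|. That is, the LTS-Godunov and LTS-Roe partial viscosity coefficients coincide unless the local characteristic Courant number λ f'(u) attains the corresponding integer value ∓i inside the interval between u_L and u_R. -/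
theorem mem_uIcc_of_deriv_ne_zero {w : ℝ → ℝ} {a b : ℝ} (hw : Continuous w)
    (hd : ∀ u ∈ Set.Ioo a b, deriv w u ≠ 0) {x : ℝ} (hx : x ∈ Set.Icc a b) :
    w x ∈ Set.uIcc (w a) (w b) := by
  have hab : a ≤ b := hx.1.trans hx.2
  have not_eq : ∀ y ∈ Set.Icc a b, ∀ z ∈ Set.Icc a b, y < z → w y ≠ w z := by
    intro y hy z hz hyz he
    obtain ⟨c, hc, hc0⟩ := exists_deriv_eq_zero hyz hw.continuousOn he
    exact hd c ⟨hy.1.trans_lt hc.1, hc.2.trans_le hz.2⟩ hc0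
  have hinj : Set.InjOn w (Set.Icc a b) := by
    intro y hy z hz he
    rcases lt_trichotomy y z with hlt | heq | hlt
    · exact absurd he (not_eq y hy z hz hlt)
    · exact heq
    · exact absurd he.symm (not_eq z hz y hy hlt)
  have ha : a ∈ Set.Icc a b := Set.left_mem_Icc.2 hab
  have hb : b ∈ Set.Icc a b := Set.right_mem_Icc.2 hab
  rcases hw.continuousOn.strictMonoOn_of_injOn_Icc' hab hinj with hm | hm
  · exact Set.mem_uIcc_of_le (hm.monotoneOn ha hx hx.1) (hm.monotoneOn hx hb hx.2)
  · exact Set.mem_uIcc_of_ge (hm.antitoneOn hx hb hx.2) (hm.antitoneOn ha hx hx.1)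

theorem isLeast_image_Icc_of_deriv_ne_zero {w : ℝ → ℝ} {a b : ℝ} (hw : Continuous w)
    (hab : a ≤ b) (hd : ∀ u ∈ Set.Ioo a b, deriv w u ≠ 0) :
    IsLeast (w '' Set.Icc a b) (min (w a) (w b)) := by
  refine ⟨?_, ?_⟩
  · rcases min_choice (w a) (w b) with he | he <;> rw [he]
    · exact Set.mem_image_of_mem w (Set.left_mem_Icc.2 hab)
    · exact Set.mem_image_of_mem w (Set.right_mem_Icc.2 hab)
  · rintro _ ⟨x, hx, rfl⟩
    exact (mem_uIcc_of_deriv_ne_zero hw hd hx).1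

theorem isGreatest_image_Icc_of_deriv_ne_zero {w : ℝ → ℝ} {a b : ℝ} (hw : Continuous w)
    (hab : a ≤ b) (hd : ∀ u ∈ Set.Ioo a b, deriv w u ≠ 0) :
    IsGreatest (w '' Set.Icc a b) (max (w a) (w b)) := by
  refine ⟨?_, ?_⟩
  · rcases max_choice (w a) (w b) with he | he <;> rw [he]
    · exact Set.mem_image_of_mem w (Set.left_mem_Icc.2 hab)
    · exact Set.mem_image_of_mem w (Set.right_mem_Icc.2 hab)
  · rintro _ ⟨x, hx, rfl⟩
    exact (mem_uIcc_of_deriv_ne_zero hw hd hx).2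

theorem left_sub_Mgod_div {w : ℝ → ℝ} {uL uR : ℝ} (hw : Continuous w) (h : uL ≠ uR)
    (hd : ∀ u ∈ Set.Ioo (min uL uR) (max uL uR), deriv w u ≠ 0) :
    (w uL - Mgod uL uR w) / (uR - uL) = max 0 (-((w uR - w uL) / (uR - uL))) := by
  rcases h.lt_or_gt with hlt | hlt
  · rw [min_eq_left hlt.le, max_eq_right hlt.le] at hd
    rw [Mgod, if_pos hlt, (isLeast_image_Icc_of_deriv_ne_zero hw hlt.le hd).csInf_eq, ← neg_div]
    have hpos : 0 < uR - uL := sub_pos.2 hlt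
    rcases le_total (w uL) (w uR) with hle | hle
    · rw [min_eq_left hle, max_eq_left (div_nonpos_of_nonpos_of_nonneg (by linarith) hpos.le)]
      simp
    · rw [min_eq_right hle, max_eq_right (div_nonneg (by linarith) hpos.le), neg_sub]
  · rw [min_eq_right hlt.le, max_eq_left hlt.le] at hd
    rw [Mgod, if_neg hlt.not_gt, (isGreatest_image_Icc_of_deriv_ne_zero hw hlt.le hd).csSup_eq,
      ← neg_div]
    have hneg : uR - uL < 0 := sub_neg.2 hlt
    rcases le_total (w uL) (w uR) with hle | hle
    · rw [max_eq_left hle, max_eq_right (div_nonneg_of_nonpos (by linarith) hneg.le), neg_sub]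
    · rw [max_eq_right hle, max_eq_left (div_nonpos_of_nonneg_of_nonpos (by linarith) hneg.le)]
      simp

theorem right_sub_Mgod_div {w : ℝ → ℝ} {uL uR : ℝ} (hw : Continuous w) (h : uL ≠ uR)
    (hd : ∀ u ∈ Set.Ioo (min uL uR) (max uL uR), deriv w u ≠ 0) :
    (w uR - Mgod uL uR w) / (uR - uL) = max 0 ((w uR - w uL) / (uR - uL)) := by
  have hsplit : (w uR - Mgod uL uR w) / (uR - uL)
      = (w uL - Mgod uL uR w) / (uR - uL) + (w uR - w uL) / (uR - uL) := by ring
  rw [hsplit, left_sub_Mgod_div hw h hd, max_add, zero_add, neg_add_cancel, max_comm]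

/-- If the local characteristic Courant number `λ f'(u)` does not attain
the value `−i` (resp. `i`, resp. `0`) in the open interval between `uL` and `uR`, then
the LTS-Godunov coefficient `Q^{i+}_God` (resp. `Q^{i−}_God`, resp. `Q^0_God`) coincides
with the corresponding LTS-Roe coefficient `max(0, −C − i)` (resp. `max(0, C − i)`,
resp. `|C|`). -/
theorem stmt_19 (lam : ℝ) (hlam : 0 < lam) (f : ℝ → ℝ) (hf : Continuous f)
    (uL uR : ℝ) (h : uL ≠ uR)
    (C : ℝ) (hC : C = lam * (f uR - f uL) / (uR - uL))
    (hdiff : ∀ u ∈ Set.Ioo (min uL uR) (max uL uR), DifferentiableAt ℝ f u) :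
    (∀ i : ℕ, 1 ≤ i →
      ((∀ u ∈ Set.Ioo (min uL uR) (max uL uR), lam * deriv f u ≠ -(i : ℝ)) →
        QGodp lam f i uL uR = max 0 (-C - i)) ∧
      ((∀ u ∈ Set.Ioo (min uL uR) (max uL uR), lam * deriv f u ≠ (i : ℝ)) →
        QGodm lam f i uL uR = max 0 (C - i))) ∧
    ((∀ u ∈ Set.Ioo (min uL uR) (max uL uR), deriv f u ≠ 0) →
      QGod0 lam f uL uR = |C|) := by
  have hne : uR - uL ≠ 0 := sub_ne_zero.2 h.symm
  have hderiv : ∀ k : ℝ, ∀ u ∈ Set.Ioo (min uL uR) (max uL uR),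
      deriv (fun v => lam * f v + k * v) u = lam * deriv f u + k := by
    intro k u hu
    have hlin : HasDerivAt (fun v : ℝ => k * v) k u := by
      simpa using (hasDerivAt_id u).const_mul k
    exact (((hdiff u hu).hasDerivAt.const_mul lam).add hlin).deriv
  have hcont : ∀ k : ℝ, Continuous fun v => lam * f v + k * v := fun k => by fun_prop
  refine ⟨fun i _ => ⟨fun hi => ?_, fun hi => ?_⟩, fun h0 => ?_⟩
  · rw [QGodp, left_sub_Mgod_div (hcont i) h fun u hu => ?_, hC]
    · congr 1
      field_simp
      ring
    · rw [hderiv i u hu]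
      exact fun he => hi u hu (eq_neg_of_add_eq_zero_left he)
  · have hfun : (fun v => lam * f v - i * v) = fun v => lam * f v + (-(i : ℝ)) * v := by
      funext v
      ring
    have hcont' : Continuous fun v => lam * f v - i * v := hfun ▸ hcont (-(i : ℝ))
    rw [QGodm, right_sub_Mgod_div hcont' h fun u hu => ?_, hC]
    · congr 1
      field_simp
      ring
    · rw [hfun, hderiv _ u hu]
      exact fun he => hi u hu (by linarith)
  · have hsplit : QGod0 lam f uL uR
        = lam * ((f uL - Mgod uL uR f) / (uR - uL) + (f uR - Mgod uL uR f) / (uR - uL)) := by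
      rw [QGod0]
      ring
    rw [hsplit, left_sub_Mgod_div hf h h0, right_sub_Mgod_div hf h h0, hC, mul_div_assoc, abs_mul,
      abs_of_pos hlam]
    congr 1
    rcases le_total 0 ((f uR - f uL) / (uR - uL)) with hs | hs
    · rw [max_eq_left (neg_nonpos.2 hs), max_eq_right hs, abs_of_nonneg hs, zero_add]
    · rw [max_eq_right (neg_nonneg.2 hs), max_eq_left hs, abs_of_nonpos hs, add_zero]
end
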